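/- arXiv:1806.08510 — 2 statements merged into one kernel-verified Lean document; each statement's English description precedes it below -/
import Mathlib

section
/- Let c > 0 and let u be a positive radial C² solution of -cΔu = u⁵ on ℝ³ with ∫_{ℝ³}|∇u|² dx < ∞. Define 𝒜φ = -cΔφ - 5u⁴φ. If φ : ℝ³ → ℝ is a C² function with ∫_{ℝ³}|∇φ|² dx < ∞ and 𝒜φ = 0 pointwise on ℝ³, then there exist real constants λ₀, λ₁, λ₂, λ₃ such that φ(x) = λ₀(u(x)/2 + x·∇u(x)) + λ₁ ∂u/∂x₁(x) + λ₂ ∂u/∂x₂(x) + λ₃ ∂u/∂x₃(x) for all x ∈ ℝ³. -/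
open MeasureTheory
open scoped RealInnerProductSpace

noncomputable section

/-- Euclidean space `ℝ³`. -/
abbrev R3 : Type := EuclideanSpace ℝ (Fin 3)

/-- The Laplacian `Δu = ∑ᵢ ∂²u/∂xᵢ²` on `ℝ³`. -/
noncomputable def lap (u : R3 → ℝ) (x : R3) : ℝ :=
  ∑ i : Fin 3,
    fderiv ℝ (fun y => fderiv ℝ u y (EuclideanSpace.single i 1)) x (EuclideanSpace.single i 1)

/-- The Aubin–Talenti bubble `Q(x) = 3^(1/4) (1 + |x|²)^(-1/2)` on `ℝ³`. -/
noncomputable def Qb (x : R3) : ℝ := (3 : ℝ) ^ ((1 : ℝ) / 4) * (1 + ‖x‖ ^ 2) ^ (-(1 : ℝ) / 2)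

/-! ### Partial derivatives and integration by parts on `ℝ³` -/

/-- The partial derivative `∂f/∂xᵢ` on `ℝ³`. -/
def pd (i : Fin 3) (f : R3 → ℝ) (x : R3) : ℝ := fderiv ℝ f x (EuclideanSpace.single i 1)

lemma lap_eq_sum_pd (f : R3 → ℝ) (x : R3) : lap f x = ∑ i, pd i (pd i f) x := rfl

lemma pd_const (i : Fin 3) (a : ℝ) (x : R3) : pd i (fun _ => a) x = 0 := by
  simp [pd]

lemma pd_coord (i k : Fin 3) (x : R3) : pd i (fun y => y k) x = if k = i then 1 else 0 := by
  have h : HasFDerivAt (fun y : R3 => y k) (EuclideanSpace.proj k : R3 →L[ℝ] ℝ) x :=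
    (EuclideanSpace.proj k : R3 →L[ℝ] ℝ).hasFDerivAt
  rw [pd, h.fderiv]
  simp

lemma pd_add {f g : R3 → ℝ} {x : R3} (i : Fin 3) (hf : DifferentiableAt ℝ f x)
    (hg : DifferentiableAt ℝ g x) : pd i (fun y => f y + g y) x = pd i f x + pd i g x := by
  simp [pd, fderiv_fun_add hf hg]

lemma pd_sub {f g : R3 → ℝ} {x : R3} (i : Fin 3) (hf : DifferentiableAt ℝ f x)
    (hg : DifferentiableAt ℝ g x) : pd i (fun y => f y - g y) x = pd i f x - pd i g x := by
  simp [pd, fderiv_fun_sub hf hg]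

lemma pd_mul {f g : R3 → ℝ} {x : R3} (i : Fin 3) (hf : DifferentiableAt ℝ f x)
    (hg : DifferentiableAt ℝ g x) :
    pd i (fun y => f y * g y) x = pd i f x * g x + f x * pd i g x := by
  simp [pd, fderiv_fun_mul hf hg]
  ring

lemma pd_const_mul {f : R3 → ℝ} {x : R3} (i : Fin 3) (a : ℝ) (hf : DifferentiableAt ℝ f x) :
    pd i (fun y => a * f y) x = a * pd i f x := by
  simp [pd, fderiv_const_mul hf]

lemma pd_comp {g : ℝ → ℝ} {f : R3 → ℝ} {x : R3} {g' : ℝ} (i : Fin 3)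
    (hg : HasDerivAt g g' (f x)) (hf : DifferentiableAt ℝ f x) :
    pd i (fun y => g (f y)) x = g' * pd i f x := by
  have := (hg.comp_hasFDerivAt x hf.hasFDerivAt).fderiv
  simp only [pd]
  rw [show (fun y => g (f y)) = g ∘ f from rfl, this]
  simp

lemma contDiff_pd {f : R3 → ℝ} (hf : ContDiff ℝ 2 f) (i : Fin 3) : ContDiff ℝ 1 (pd i f) :=
  (hf.fderiv_right (m := 1) (by norm_num)).clm_apply contDiff_const

lemma continuous_pd {f : R3 → ℝ} (hf : ContDiff ℝ 1 f) (i : Fin 3) : Continuous (pd i f) :=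
  (hf.continuous_fderiv (by norm_num)).clm_apply continuous_const

lemma pd_comm {f : R3 → ℝ} (hf : ContDiff ℝ 2 f) (i j : Fin 3) (x : R3) :
    pd i (pd j f) x = pd j (pd i f) x := by
  have hd : DifferentiableAt ℝ (fderiv ℝ f) x :=
    (hf.fderiv_right (m := 1) (by norm_num)).differentiable (by norm_num) x
  have key : ∀ a b : Fin 3, pd a (pd b f) x =
      fderiv ℝ (fderiv ℝ f) x (EuclideanSpace.single a 1) (EuclideanSpace.single b 1) := by
    intro a b
    have := (hd.hasFDerivAt.clm_apply
      (hasFDerivAt_const (EuclideanSpace.single b (1 : ℝ) : R3) x)).fderiv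
    change fderiv ℝ (fun y => fderiv ℝ f y (EuclideanSpace.single b 1)) x _ = _
    rw [this]
    simp
  rw [key, key]
  exact (hf.contDiffAt.isSymmSndFDerivAt (by simp)) _ _

lemma fderiv_eq_sum_pd (f : R3 → ℝ) (x v : R3) : fderiv ℝ f x v = ∑ i, v i * pd i f x := by
  have hv : v = ∑ i, v i • (EuclideanSpace.single i (1 : ℝ) : R3) := by
    ext j
    simp [Pi.single_apply]
  conv_lhs => rw [hv]
  simp [pd]

lemma inner_gradient (f : R3 → ℝ) (x : R3) : ⟪x, gradient f x⟫ = ∑ i, x i * pd i f x := by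
  rw [real_inner_comm, gradient, InnerProductSpace.toDual_symm_apply, fderiv_eq_sum_pd]

lemma norm_gradient_sq (f : R3 → ℝ) (x : R3) : ‖gradient f x‖ ^ 2 = ∑ i, pd i f x ^ 2 := by
  rw [EuclideanSpace.real_norm_sq_eq]
  refine Finset.sum_congr rfl fun i _ => ?_
  have : gradient f x i = ⟪gradient f x, EuclideanSpace.single i (1 : ℝ)⟫ := by
    rw [EuclideanSpace.inner_single_right]
    simp
  rw [this, gradient, InnerProductSpace.toDual_symm_apply, pd]

lemma HasCompactSupport.pd {f : R3 → ℝ} (hf : HasCompactSupport f) (i : Fin 3) :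
    HasCompactSupport (pd i f) :=
  hf.fderiv_apply (𝕜 := ℝ) (EuclideanSpace.single i 1)

/-- Integration by parts against a compactly supported function. -/
lemma integral_pd_mul {f g : R3 → ℝ} (hf : ContDiff ℝ 1 f) (hg : ContDiff ℝ 1 g)
    (hc : HasCompactSupport g) (i : Fin 3) :
    ∫ x, pd i f x * g x = -∫ x, f x * pd i g x := by
  have h := integral_mul_fderiv_eq_neg_fderiv_mul_of_integrable (μ := (volume : Measure R3))
    (f := f) (g := g) (v := EuclideanSpace.single i (1 : ℝ))
    (((continuous_pd hf i).mul hg.continuous).integrable_of_hasCompactSupport hc.mul_left)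
    ((hf.continuous.mul (continuous_pd hg i)).integrable_of_hasCompactSupport
      (hc.pd i).mul_left)
    ((hf.continuous.mul hg.continuous).integrable_of_hasCompactSupport hc.mul_left)
    (fun x _ => hf.differentiable (by norm_num) x)
    (fun x _ => hg.differentiable (by norm_num) x)
  rw [eq_comm, neg_eq_iff_eq_neg]
  exact h

/-- Differentiating the translates of `f` in a weighted integral. -/
lemma hasDerivAt_integral_translate {f Y : R3 → ℝ} (hf : ContDiff ℝ 1 f) (hY : Continuous Y)
    (hc : HasCompactSupport Y) (j : Fin 3) :
    HasDerivAt (fun t : ℝ => ∫ x, f (x + t • EuclideanSpace.single j 1) * Y x)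
      (∫ x, pd j f x * Y x) 0 := by
  set e : R3 := EuclideanSpace.single j 1
  have hcpt : IsCompact ((fun p : R3 × ℝ => p.1 + p.2 • e) '' (tsupport Y ×ˢ Set.Icc (-1) 1)) :=
    (hc.isCompact.prod isCompact_Icc).image (by fun_prop)
  obtain ⟨M, hM⟩ := hcpt.exists_bound_of_continuousOn (continuous_pd hf j).continuousOn
  have hcp := continuous_pd hf j
  have hcf := hf.continuous
  have h := hasDerivAt_integral_of_dominated_loc_of_deriv_le (μ := (volume : Measure R3))
    (F := fun (t : ℝ) x => f (x + t • e) * Y x) (F' := fun (t : ℝ) x => pd j f (x + t • e) * Y x)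
    (x₀ := 0) (s := Set.Icc (-1) 1) (bound := fun x => M * ‖Y x‖)
    (Icc_mem_nhds (by norm_num) (by norm_num))
    (Filter.Eventually.of_forall fun t =>
      (Continuous.aestronglyMeasurable (by fun_prop)))
    (Continuous.integrable_of_hasCompactSupport (by fun_prop) hc.mul_left)
    (Continuous.aestronglyMeasurable (by fun_prop))
    (Filter.Eventually.of_forall fun x t ht => by
      rw [norm_mul]
      by_cases hx : x ∈ tsupport Y
      · exact mul_le_mul_of_nonneg_right (hM _ ⟨(x, t), ⟨hx, ht⟩, rfl⟩) (norm_nonneg _)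
      · simp [image_eq_zero_of_notMem_tsupport hx])
    ((hY.integrable_of_hasCompactSupport hc).norm.const_mul M)
    (Filter.Eventually.of_forall fun x t _ => by
      have h1 : HasDerivAt (fun t : ℝ => x + t • e) e t := by
        simpa using ((hasDerivAt_id t).smul_const e).const_add x
      have h2 := (hf.differentiable (by norm_num) (x + t • e)).hasFDerivAt.comp_hasDerivAt t h1
      exact h2.mul_const (Y x))
  simpa using h.2

/-- A weak form of `Δ ∂ⱼ F = ∂ⱼ Δ F` that only needs `F` to be `C²` and `Δ F` to be `C¹`. -/
lemma integral_pd_pd_mul_pd {F Y : R3 → ℝ} (hF : ContDiff ℝ 2 F) (hS : ContDiff ℝ 1 (lap F))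
    (hY : ContDiff ℝ 1 Y) (hc : HasCompactSupport Y) (j : Fin 3) :
    ∑ i, ∫ x, pd j (pd i F) x * pd i Y x = -∫ x, pd j (lap F) x * Y x := by
  set e : R3 := EuclideanSpace.single j 1
  have h1 : HasDerivAt (fun t : ℝ => ∑ i, ∫ x, pd i F (x + t • e) * pd i Y x)
      (∑ i, ∫ x, pd j (pd i F) x * pd i Y x) 0 :=
    HasDerivAt.fun_sum fun i _ => hasDerivAt_integral_translate (contDiff_pd hF i)
      (continuous_pd hY i) (hc.pd i) j
  have h2 : HasDerivAt (fun t : ℝ => -∫ x, lap F (x + t • e) * Y x)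
      (-∫ x, pd j (lap F) x * Y x) 0 :=
    (hasDerivAt_integral_translate hS hY.continuous hc j).neg
  have heq : (fun t : ℝ => ∑ i, ∫ x, pd i F (x + t • e) * pd i Y x) =
      fun t : ℝ => -∫ x, lap F (x + t • e) * Y x := by
    funext t
    have htr : ∀ i, ∀ x, pd i (fun y => pd i F (y + t • e)) x = pd i (pd i F) (x + t • e) := by
      intro i x
      change fderiv ℝ (fun y => pd i F (y + t • e)) x _ = fderiv ℝ (pd i F) (x + t • e) _
      rw [fderiv_comp_add_right]
    have hcd : ∀ i, ContDiff ℝ 1 (fun y => pd i F (y + t • e)) := fun i =>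
      (contDiff_pd hF i).comp (contDiff_id.add contDiff_const)
    have hibp : ∀ i, ∫ x, pd i F (x + t • e) * pd i Y x =
        -∫ x, pd i (pd i F) (x + t • e) * Y x := by
      intro i
      have := integral_pd_mul (hcd i) hY hc i
      simp only [htr] at this
      rw [this, neg_neg]
    simp only [hibp, lap_eq_sum_pd, Finset.sum_mul, Finset.sum_neg_distrib]
    rw [integral_finsetSum]
    intro i _
    have hcc := continuous_pd (contDiff_pd hF i) i
    have hcY := hY.continuous
    exact Continuous.integrable_of_hasCompactSupport (by fun_prop) hc.mul_left
  rw [heq] at h1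
  exact h1.unique h2

/-! ### The Japanese bracket `√(1 + |x|²)` -/

/-- The Japanese bracket `√(1 + |x|²)` on `ℝ³`. -/
def jb (x : R3) : ℝ := √(1 + ‖x‖ ^ 2)

lemma jb_sq (x : R3) : jb x ^ 2 = 1 + ‖x‖ ^ 2 := Real.sq_sqrt (by positivity)

lemma jb_sq_sum (x : R3) : jb x ^ 2 = 1 + ∑ i, x i ^ 2 := by
  rw [jb_sq, EuclideanSpace.real_norm_sq_eq]

lemma one_le_jb (x : R3) : 1 ≤ jb x := Real.one_le_sqrt.2 (by nlinarith [sq_nonneg ‖x‖])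

lemma jb_pos (x : R3) : 0 < jb x := zero_lt_one.trans_le (one_le_jb x)

lemma norm_le_jb (x : R3) : ‖x‖ ≤ jb x := Real.le_sqrt_of_sq_le (by linarith)

lemma contDiff_jb {n : WithTop ℕ∞} : ContDiff ℝ n jb :=
  (contDiff_const.add (contDiff_norm_sq ℝ)).sqrt fun x => by positivity

lemma differentiable_jb : Differentiable ℝ jb := contDiff_jb.differentiable (n := 1) (by norm_num)

lemma pd_norm_sq (i : Fin 3) (x : R3) : pd i (fun y => ‖y‖ ^ 2) x = 2 * x i := by
  rw [pd, fderiv_norm_sq_apply]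
  simp [EuclideanSpace.inner_single_right]

lemma pd_jb (i : Fin 3) (x : R3) : pd i jb x = x i / jb x := by
  have h0 : (1 + ‖x‖ ^ 2) ≠ 0 := by positivity
  have hd : DifferentiableAt ℝ (fun y : R3 => 1 + ‖y‖ ^ 2) x :=
    (contDiff_const.add (contDiff_norm_sq ℝ)).differentiable (n := 1) (by norm_num) x
  have := pd_comp i (Real.hasDerivAt_sqrt h0) hd
  change pd i (fun y => √(1 + ‖y‖ ^ 2)) x = _
  rw [this, pd_add i (differentiableAt_const _) ((contDiff_norm_sq ℝ (n := 1)).differentiable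
    (by norm_num) x), pd_const, pd_norm_sq]
  change 1 / (2 * jb x) * (0 + 2 * x i) = _
  have := (jb_pos x).ne'
  field_simp
  ring

lemma differentiable_jb_pow (n : ℕ) : Differentiable ℝ (fun y => jb y ^ n) :=
  (contDiff_jb.pow n).differentiable (n := 1) (by norm_num)

lemma pd_jb_pow (n : ℕ) (i : Fin 3) (x : R3) :
    pd i (fun y => jb y ^ n) x = n * jb x ^ (n - 1) * (x i / jb x) := by
  rw [pd_comp i (hasDerivAt_pow n (jb x)) (differentiable_jb x), pd_jb]

lemma pd_jb_pow_inv (n : ℕ) (i : Fin 3) (x : R3) :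
    pd i (fun y => (jb y ^ n)⁻¹) x = -(n * x i) / jb x ^ (n + 2) := by
  have h0 := (jb_pos x).ne'
  rw [pd_comp i (hasDerivAt_inv (pow_ne_zero n h0)) (differentiable_jb_pow n x), pd_jb_pow]
  rcases n with _ | n
  · simp
  · simp only [Nat.add_sub_cancel]
    field_simp
    ring

lemma contDiff_jb_pow_inv {m : WithTop ℕ∞} (n : ℕ) : ContDiff ℝ m (fun y => (jb y ^ n)⁻¹) :=
  (contDiff_jb.pow n).inv fun x => pow_ne_zero n (jb_pos x).ne'

lemma contDiff_coord {m : WithTop ℕ∞} (i : Fin 3) : ContDiff ℝ m (fun x : R3 => x i) :=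
  (EuclideanSpace.proj i : R3 →L[ℝ] ℝ).contDiff

lemma differentiable_coord (i : Fin 3) : Differentiable ℝ (fun x : R3 => x i) :=
  (contDiff_coord (m := 1) i).differentiable (by norm_num)

/-! ### The conformally weighted equation -/

/-- The gradient of `(1 + |x|²)^(3/2) φ`. -/
lemma pd_jb_cube_mul {φ : R3 → ℝ} (hφ : Differentiable ℝ φ) (i : Fin 3) (x : R3) :
    pd i (fun y => jb y ^ 3 * φ y) x = 3 * (jb x * (x i * φ x)) + jb x ^ 3 * pd i φ x := by
  have h0 := (jb_pos x).ne'
  rw [pd_mul i (differentiable_jb_pow 3 x) (hφ x), pd_jb_pow]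
  field_simp
  push_cast
  ring

lemma lap_jb_cube_mul {φ : R3 → ℝ} (hφ : ContDiff ℝ 2 φ)
    (hker : ∀ x, lap φ x = -(15 * φ x / jb x ^ 4)) (x : R3) :
    lap (fun y => jb y ^ 3 * φ y) x =
      6 * ((∑ i, x i * pd i (fun y => jb y ^ 3 * φ y) x) - jb x ^ 3 * φ x) * (jb x ^ 2)⁻¹ := by
  have h0 := (jb_pos x).ne'
  have hd : Differentiable ℝ φ := hφ.differentiable (by norm_num)
  have hd' : ∀ i, Differentiable ℝ (pd i φ) := fun i =>
    (contDiff_pd hφ i).differentiable (by norm_num)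
  have h2 : ∀ i, pd i (pd i (fun y => jb y ^ 3 * φ y)) x =
      3 * (x i ^ 2 / jb x) * φ x + 3 * jb x * φ x + 6 * jb x * x i * pd i φ x
        + jb x ^ 3 * pd i (pd i φ) x := by
    intro i
    have h1 : pd i (fun y => jb y ^ 3 * φ y) =
        fun x => 3 * (jb x * (x i * φ x)) + jb x ^ 3 * pd i φ x :=
      funext (pd_jb_cube_mul hd i)
    have hxi := differentiable_coord i
    have hj := differentiable_jb
    have hdi := hd' i
    rw [h1, pd_add i (by fun_prop) (by fun_prop), pd_const_mul i _ (by fun_prop),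
      pd_mul i (by fun_prop) (by fun_prop), pd_mul i (by fun_prop) (by fun_prop),
      pd_mul i (by fun_prop) (by fun_prop), pd_jb, pd_jb_pow, pd_coord]
    simp
    field_simp
    ring
  have hs := jb_sq_sum x
  have hk := hker x
  simp only [lap_eq_sum_pd, h2, pd_jb_cube_mul hd, Fin.sum_univ_three] at hk hs ⊢
  have e : x 2 ^ 2 = jb x ^ 2 - 1 - x 0 ^ 2 - x 1 ^ 2 := by linarith
  have e' : pd 2 (pd 2 φ) x = -(15 * φ x / jb x ^ 4) - pd 0 (pd 0 φ) x - pd 1 (pd 1 φ) x := by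
    linarith
  rw [e', e]
  field_simp
  linear_combination -(18 * φ x) * e

/-- The trace-free Hessian of `F`. -/
def tfHess (F : R3 → ℝ) (i j : Fin 3) (x : R3) : ℝ :=
  pd i (pd j F) x - if i = j then lap F x / 3 else 0

lemma contDiff_lap_of_conformal {F : R3 → ℝ} (hF : ContDiff ℝ 2 F)
    (hPDE : ∀ x, lap F x = 6 * ((∑ i, x i * pd i F x) - F x) * (jb x ^ 2)⁻¹) :
    ContDiff ℝ 1 (lap F) := by
  have h : lap F = fun x => 6 * ((∑ i, x i * pd i F x) - F x) * (jb x ^ 2)⁻¹ := funext hPDE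
  rw [h]
  exact (contDiff_const.mul ((ContDiff.sum fun i _ => (contDiff_coord i).mul
    (contDiff_pd hF i)).sub (hF.of_le (by norm_num)))).mul (contDiff_jb_pow_inv 2)

lemma pd_lap_of_conformal {F : R3 → ℝ} (hF : ContDiff ℝ 2 F)
    (hPDE : ∀ x, lap F x = 6 * ((∑ i, x i * pd i F x) - F x) * (jb x ^ 2)⁻¹)
    (j : Fin 3) (x : R3) :
    pd j (lap F) x = 6 * (jb x ^ 2)⁻¹ * ∑ i, x i * tfHess F j i x := by
  have h0 := (jb_pos x).ne'
  have h : lap F = fun x => 6 * ((x 0 * pd 0 F x + x 1 * pd 1 F x + x 2 * pd 2 F x) - F x) *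
      (jb x ^ 2)⁻¹ := by
    funext x
    rw [hPDE, Fin.sum_univ_three]
  have hx0 := differentiable_coord 0
  have hx1 := differentiable_coord 1
  have hx2 := differentiable_coord 2
  have hp0 := (contDiff_pd hF 0).differentiable (by norm_num)
  have hp1 := (contDiff_pd hF 1).differentiable (by norm_num)
  have hp2 := (contDiff_pd hF 2).differentiable (by norm_num)
  have hFd : Differentiable ℝ F := hF.differentiable (by norm_num)
  have hw : Differentiable ℝ (fun y => (jb y ^ 2)⁻¹) :=
    (contDiff_jb_pow_inv (m := 1) 2).differentiable (by norm_num)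
  have hL := congrFun h x
  have h1 : pd j (lap F) x = 6 * (x 0 * pd j (pd 0 F) x + x 1 * pd j (pd 1 F) x
      + x 2 * pd j (pd 2 F) x) * (jb x ^ 2)⁻¹ - 2 * x j * (jb x ^ 2)⁻¹ * lap F x := by
    rw [hL, h, pd_mul j (by fun_prop) (hw x), pd_const_mul j _ (by fun_prop),
      pd_sub j (by fun_prop) (hFd x), pd_add j (by fun_prop) (by fun_prop),
      pd_add j (by fun_prop) (by fun_prop),
      pd_mul j (by fun_prop) (by fun_prop), pd_mul j (by fun_prop) (by fun_prop),
      pd_mul j (by fun_prop) (by fun_prop), pd_jb_pow_inv]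
    simp only [pd_coord]
    fin_cases j <;> simp <;> field_simp <;> ring
  rw [h1]
  simp only [tfHess, Fin.sum_univ_three]
  fin_cases j <;> simp <;> ring

/-- The weighted energy identity for the trace-free Hessian. -/
lemma integral_tfHess_identity {F : R3 → ℝ} (hF : ContDiff ℝ 2 F)
    (hPDE : ∀ x, lap F x = 6 * ((∑ i, x i * pd i F x) - F x) * (jb x ^ 2)⁻¹)
    {η : R3 → ℝ} (hη : ContDiff ℝ 1 η) (hc : HasCompactSupport η) :
    ∫ x, η x * (jb x ^ 4)⁻¹ * ∑ i, ∑ j, tfHess F i j x ^ 2 =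
      -∫ x, (jb x ^ 4)⁻¹ * ∑ i, ∑ j, tfHess F i j x * pd i η x * pd j F x := by
  have hS := contDiff_lap_of_conformal hF hPDE
  set Y : Fin 3 → R3 → ℝ := fun j x => η x * ((jb x ^ 4)⁻¹ * pd j F x) with hYdef
  have hY : ∀ j, ContDiff ℝ 1 (Y j) := fun j =>
    hη.mul ((contDiff_jb_pow_inv 4).mul (contDiff_pd hF j))
  have hYc : ∀ j, HasCompactSupport (Y j) := fun j => hc.mul_right
  have hint : ∀ (g f : R3 → ℝ), Continuous g → Continuous f → HasCompactSupport f →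
      Integrable (fun x => g x * f x) := fun g f hg hf hcf =>
    (hg.mul hf).integrable_of_hasCompactSupport hcf.mul_left
  have hpp : ∀ i j, Continuous (pd i (pd j F)) := fun i j => continuous_pd (contDiff_pd hF j) i
  have hk : Continuous (fun x => (jb x ^ 4)⁻¹) := (contDiff_jb_pow_inv (m := 1) 4).continuous
  have hT : ∀ i j, Continuous (tfHess F i j) := by
    intro i j
    have := hS.continuous
    have := hpp i j
    unfold tfHess
    split_ifs <;> fun_prop
  have hzero : ∑ j, ((∑ i, ∫ x, pd j (pd i F) x * pd i (Y j) x)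
      - 1 / 3 * (∫ x, lap F x * pd j (Y j) x) + 2 / 3 * ∫ x, pd j (lap F) x * Y j x) = 0 := by
    refine Finset.sum_eq_zero fun j _ => ?_
    rw [integral_pd_pd_mul_pd hF hS (hY j) (hYc j) j, integral_pd_mul hS (hY j) (hYc j) j]
    ring
  have hone : ∑ j, ((∑ i, ∫ x, pd j (pd i F) x * pd i (Y j) x)
      - 1 / 3 * (∫ x, lap F x * pd j (Y j) x) + 2 / 3 * ∫ x, pd j (lap F) x * Y j x) =
      ∫ x, ∑ j, ((∑ i, pd j (pd i F) x * pd i (Y j) x)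
      - 1 / 3 * (lap F x * pd j (Y j) x) + 2 / 3 * (pd j (lap F) x * Y j x)) := by
    have i1 : ∀ j, ∀ i, Integrable (fun x => pd j (pd i F) x * pd i (Y j) x) := fun j i =>
      hint _ _ (hpp j i) (continuous_pd (hY j) i) ((hYc j).pd i)
    have i2 : ∀ j, Integrable (fun x => lap F x * pd j (Y j) x) := fun j =>
      hint _ _ hS.continuous (continuous_pd (hY j) j) ((hYc j).pd j)
    have i3 : ∀ j, Integrable (fun x => pd j (lap F) x * Y j x) := fun j =>
      hint _ _ (continuous_pd hS j) (hY j).continuous (hYc j)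
    have i4 : ∀ j, Integrable (fun x => ∑ i, pd j (pd i F) x * pd i (Y j) x) := fun j =>
      integrable_finsetSum _ fun i _ => i1 j i
    have i6 : ∀ j, Integrable (fun x => (∑ i, pd j (pd i F) x * pd i (Y j) x)
        - 1 / 3 * (lap F x * pd j (Y j) x)) := fun j => (i4 j).sub ((i2 j).const_mul _)
    have i5 : ∀ j, Integrable (fun x => (∑ i, pd j (pd i F) x * pd i (Y j) x)
        - 1 / 3 * (lap F x * pd j (Y j) x) + 2 / 3 * (pd j (lap F) x * Y j x)) := fun j =>
      (i6 j).add ((i3 j).const_mul _)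
    rw [integral_finsetSum _ fun j _ => i5 j]
    refine Finset.sum_congr rfl fun j _ => ?_
    rw [integral_add (i6 j) ((i3 j).const_mul _),
      integral_sub (i4 j) ((i2 j).const_mul _), integral_finsetSum _ fun i _ => i1 j i,
      integral_const_mul, integral_const_mul]
  have hpw : ∀ x, ∑ j, ((∑ i, pd j (pd i F) x * pd i (Y j) x)
      - 1 / 3 * (lap F x * pd j (Y j) x) + 2 / 3 * (pd j (lap F) x * Y j x)) =
      η x * (jb x ^ 4)⁻¹ * (∑ i, ∑ j, tfHess F i j x ^ 2)
        + (jb x ^ 4)⁻¹ * ∑ i, ∑ j, tfHess F i j x * pd i η x * pd j F x := by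
    intro x
    have h0 := (jb_pos x).ne'
    have hYp : ∀ i j, pd i (Y j) x = pd i η x * ((jb x ^ 4)⁻¹ * pd j F x)
        + η x * (-(4 * x i) / jb x ^ 6 * pd j F x + (jb x ^ 4)⁻¹ * pd i (pd j F) x) := by
      intro i j
      have hkd : DifferentiableAt ℝ (fun x => (jb x ^ 4)⁻¹) x :=
        (contDiff_jb_pow_inv (m := 1) 4).differentiable (by norm_num) x
      have hpd : DifferentiableAt ℝ (pd j F) x :=
        (contDiff_pd hF j).differentiable (by norm_num) x
      change pd i (fun y => η y * ((jb y ^ 4)⁻¹ * pd j F y)) x = _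
      rw [pd_mul i (hη.differentiable (by norm_num) x) (hkd.fun_mul hpd), pd_mul i hkd hpd,
        pd_jb_pow_inv]
      norm_num
    have hL : lap F x = pd 0 (pd 0 F) x + pd 1 (pd 1 F) x + pd 2 (pd 2 F) x := by
      rw [lap_eq_sum_pd, Fin.sum_univ_three]
    simp only [hYp, pd_lap_of_conformal hF hPDE]
    simp only [hYdef]
    simp only [Fin.sum_univ_three, tfHess, pd_comm hF 1 0, pd_comm hF 2 0, pd_comm hF 2 1]
    simp only [Fin.isValue, ↓reduceIte, zero_ne_one, one_ne_zero, Fin.reduceEq, sub_zero]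
    generalize lap F x = S at *
    subst hL
    field_simp
    ring
  rw [hone, integral_congr_ae (Filter.Eventually.of_forall hpw)] at hzero
  rw [integral_add] at hzero
  · linarith
  · simp only [mul_assoc]
    refine Continuous.integrable_of_hasCompactSupport ?_ hc.mul_right
    have := hη.continuous
    fun_prop
  · simp only [Finset.mul_sum]
    refine integrable_finsetSum _ fun i _ => integrable_finsetSum _ fun j _ => ?_
    refine Continuous.integrable_of_hasCompactSupport ?_
      (((hc.pd i).mul_left).mul_right).mul_left
    have := continuous_pd hη i
    have := continuous_pd (hF.of_le (by norm_num)) j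
    fun_prop

/-! ### Energy estimates -/

/-- The Cauchy–Schwarz inequality for real integrals. -/
lemma sq_integral_mul_le {α : Type*} [MeasurableSpace α] {μ : Measure α} {f g : α → ℝ}
    (hf : Integrable (fun x => f x ^ 2) μ) (hg : Integrable (fun x => g x ^ 2) μ)
    (hfg : Integrable (fun x => f x * g x) μ) :
    (∫ x, f x * g x ∂μ) ^ 2 ≤ (∫ x, f x ^ 2 ∂μ) * ∫ x, g x ^ 2 ∂μ := by
  have key : ∀ t : ℝ, 0 ≤ (∫ x, g x ^ 2 ∂μ) * (t * t) + 2 * (∫ x, f x * g x ∂μ) * t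
      + ∫ x, f x ^ 2 ∂μ := by
    intro t
    have h0 : 0 ≤ ∫ x, (g x ^ 2 * (t * t) + 2 * (f x * g x) * t + f x ^ 2) ∂μ :=
      integral_nonneg fun x => (by nlinarith [sq_nonneg (g x * t + f x)] :
        (0 : ℝ) ≤ g x ^ 2 * (t * t) + 2 * (f x * g x) * t + f x ^ 2)
    have i1 : Integrable (fun x => g x ^ 2 * (t * t)) μ := hg.mul_const _
    have i2 : Integrable (fun x => 2 * (f x * g x) * t) μ := (hfg.const_mul 2).mul_const t
    have i3 : Integrable (fun x => g x ^ 2 * (t * t) + 2 * (f x * g x) * t) μ := i1.add i2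
    rwa [integral_add i3 hf, integral_add i1 i2, integral_mul_const, integral_mul_const,
      integral_const_mul] at h0
  have := discrim_le_zero key
  rw [discrim] at this
  nlinarith

lemma sq_fderiv_le (f : R3 → ℝ) (x z : R3) :
    fderiv ℝ f x z ^ 2 ≤ ‖z‖ ^ 2 * ∑ i, pd i f x ^ 2 := by
  rw [fderiv_eq_sum_pd, EuclideanSpace.real_norm_sq_eq]
  exact Finset.sum_mul_sq_le_sq_mul_sq _ _ _

lemma sq_sub_translate_le {f : R3 → ℝ} (hf : ContDiff ℝ 1 f) (x z : R3) :
    (f (x + z) - f x) ^ 2 ≤ ∫ t in Set.Ioc (0 : ℝ) 1, ‖z‖ ^ 2 * ∑ i, pd i f (x + t • z) ^ 2 := by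
  have hd : ∀ t : ℝ, HasDerivAt (fun t : ℝ => f (x + t • z)) (fderiv ℝ f (x + t • z) z) t := by
    intro t
    have h1 : HasDerivAt (fun t : ℝ => x + t • z) z t := by
      simpa using ((hasDerivAt_id t).smul_const z).const_add x
    exact (hf.differentiable (by norm_num) (x + t • z)).hasFDerivAt.comp_hasDerivAt t h1
  have hc : Continuous fun t : ℝ => fderiv ℝ f (x + t • z) z := by
    have h := hf.continuous_fderiv (by norm_num)
    exact (h.comp (by fun_prop)).clm_apply continuous_const
  have hp : ∀ i, Continuous (pd i f) := continuous_pd hf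
  have hftc : f (x + z) - f x = ∫ t in Set.Ioc (0 : ℝ) 1, fderiv ℝ f (x + t • z) z := by
    rw [← intervalIntegral.integral_of_le zero_le_one,
      intervalIntegral.integral_eq_sub_of_hasDerivAt (fun t _ => hd t)
        (hc.intervalIntegrable _ _)]
    simp
  have hint : ∀ g : ℝ → ℝ, Continuous g → IntegrableOn g (Set.Ioc 0 1) := fun g hg =>
    (hg.integrableOn_Icc (a := 0) (b := 1)).mono_set Set.Ioc_subset_Icc_self
  have hcs := sq_integral_mul_le (μ := volume.restrict (Set.Ioc (0 : ℝ) 1))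
    (f := fun _ => (1 : ℝ)) (g := fun t => fderiv ℝ f (x + t • z) z)
    (hint _ (by fun_prop)) (hint _ (by fun_prop)) (hint _ (by fun_prop))
  simp only [one_mul, one_pow, integral_const, MeasurableSet.univ, measureReal_restrict_apply,
    Set.univ_inter, Real.volume_real_Ioc, sub_zero, smul_eq_mul, mul_one] at hcs
  rw [hftc]
  refine hcs.trans ?_
  norm_num
  exact integral_mono (hint _ (by fun_prop)) (hint _ (by fun_prop)) fun t => sq_fderiv_le f _ z

open ENNReal in
/-- The `L²` norm of `f(· + z) - f` is controlled by the Dirichlet energy of `f`. -/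
lemma lintegral_sq_sub_translate_le {f : R3 → ℝ} (hf : ContDiff ℝ 1 f)
    (hE : Integrable fun x => ∑ i, pd i f x ^ 2) (z : R3) :
    ∫⁻ x, ENNReal.ofReal ((f (x + z) - f x) ^ 2) ≤
      ENNReal.ofReal (‖z‖ ^ 2 * ∫ x, ∑ i, pd i f x ^ 2) := by
  have hp : ∀ i, Continuous (pd i f) := continuous_pd hf
  have hnn : ∀ x, 0 ≤ ∑ i, pd i f x ^ 2 := fun x => Finset.sum_nonneg fun i _ => sq_nonneg _
  calc ∫⁻ x, ENNReal.ofReal ((f (x + z) - f x) ^ 2)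
      ≤ ∫⁻ x, ∫⁻ t in Set.Ioc (0 : ℝ) 1,
          ENNReal.ofReal (‖z‖ ^ 2 * ∑ i, pd i f (x + t • z) ^ 2) := by
        refine lintegral_mono fun x => ?_
        rw [← ofReal_integral_eq_lintegral_ofReal]
        · exact ENNReal.ofReal_le_ofReal (sq_sub_translate_le hf x z)
        · exact ((Continuous.integrableOn_Icc (by fun_prop)).mono_set
            Set.Ioc_subset_Icc_self)
        · exact Filter.Eventually.of_forall fun t => mul_nonneg (sq_nonneg _) (hnn _)
    _ = ∫⁻ t in Set.Ioc (0 : ℝ) 1, ∫⁻ x,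
          ENNReal.ofReal (‖z‖ ^ 2 * ∑ i, pd i f (x + t • z) ^ 2) := by
        refine lintegral_lintegral_swap ?_
        refine Measurable.aemeasurable ?_
        refine Measurable.ennreal_ofReal (Continuous.measurable ?_)
        fun_prop
    _ = ∫⁻ t in Set.Ioc (0 : ℝ) 1, ENNReal.ofReal (‖z‖ ^ 2 * ∫ x, ∑ i, pd i f x ^ 2) := by
        refine lintegral_congr fun t => ?_
        rw [lintegral_add_right_eq_self
          (fun x => ENNReal.ofReal (‖z‖ ^ 2 * ∑ i, pd i f x ^ 2)) (t • z),
          ← integral_const_mul, ofReal_integral_eq_lintegral_ofReal (hE.const_mul _)]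
        exact Filter.Eventually.of_forall fun t => mul_nonneg (sq_nonneg _) (hnn _)
    _ = ENNReal.ofReal (‖z‖ ^ 2 * ∫ x, ∑ i, pd i f x ^ 2) := by simp

lemma volume_real_ball {R : ℝ} (hR : 0 < R) :
    volume.real (Metric.ball (0 : R3) R) = R ^ 3 * volume.real (Metric.ball (0 : R3) 1) := by
  rw [measureReal_def, measureReal_def, Measure.addHaar_ball_of_pos volume 0 hR,
    ENNReal.toReal_mul, ENNReal.toReal_ofReal (by positivity)]
  simp

lemma integrableOn_ball_of_continuous {f : R3 → ℝ} (hf : Continuous f) (R : ℝ) :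
    IntegrableOn f (Metric.ball 0 R) :=
  (hf.continuousOn.integrableOn_compact (isCompact_closedBall 0 R)).mono_set
    Metric.ball_subset_closedBall

/-- A Poincaré inequality on balls, in terms of double integrals. -/
lemma integral_integral_sq_sub_le {f : R3 → ℝ} (hf : ContDiff ℝ 1 f)
    (hE : Integrable fun x => ∑ i, pd i f x ^ 2) {R : ℝ} (hR : 0 < R) :
    ∫ x in Metric.ball 0 R, ∫ y in Metric.ball 0 R, (f x - f y) ^ 2 ≤
      volume.real (Metric.ball (0 : R3) (2 * R)) * ((2 * R) ^ 2 * ∫ x, ∑ i, pd i f x ^ 2) := by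
  have hfc := hf.continuous
  have hE0 : 0 ≤ ∫ x, ∑ i, pd i f x ^ 2 :=
    integral_nonneg fun x => Finset.sum_nonneg fun i _ => sq_nonneg _
  have hin : ∀ x, Integrable (fun y => (f x - f y) ^ 2) (volume.restrict (Metric.ball 0 R)) :=
    fun x => integrableOn_ball_of_continuous (by fun_prop) R
  rw [integral_eq_lintegral_of_nonneg_ae
    (Filter.Eventually.of_forall fun x => integral_nonneg fun y => sq_nonneg _)]
  swap
  · refine AEStronglyMeasurable.integral_prod_right' (f := fun p : R3 × R3 => (f p.1 - f p.2) ^ 2) ?_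
    exact Continuous.aestronglyMeasurable (by fun_prop)
  refine ENNReal.toReal_le_of_le_ofReal (by positivity) ?_
  calc ∫⁻ x in Metric.ball 0 R, ENNReal.ofReal (∫ y in Metric.ball 0 R, (f x - f y) ^ 2)
      = ∫⁻ x in Metric.ball 0 R, ∫⁻ y in Metric.ball 0 R, ENNReal.ofReal ((f x - f y) ^ 2) := by
        refine lintegral_congr fun x => ?_
        exact ofReal_integral_eq_lintegral_ofReal (hin x)
          (Filter.Eventually.of_forall fun y => sq_nonneg _)
    _ ≤ ∫⁻ x in Metric.ball 0 R, ∫⁻ z in Metric.ball 0 (2 * R),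
          ENNReal.ofReal ((f (x + z) - f x) ^ 2) := by
        refine setLIntegral_mono' Metric.isOpen_ball.measurableSet fun x hx => ?_
        rw [← lintegral_indicator Metric.isOpen_ball.measurableSet,
          ← lintegral_indicator Metric.isOpen_ball.measurableSet,
          ← lintegral_add_left_eq_self _ x]
        refine lintegral_mono fun z => ?_
        by_cases hz : x + z ∈ Metric.ball (0 : R3) R
        · have hz' : z ∈ Metric.ball (0 : R3) (2 * R) := by
            simp only [mem_ball_zero_iff] at hx hz ⊢
            have := norm_sub_le (x + z) x
            rw [add_sub_cancel_left] at this
            linarith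
          rw [Set.indicator_of_mem hz, Set.indicator_of_mem hz']
          apply le_of_eq
          congr 1
          ring
        · rw [Set.indicator_of_notMem hz]
          exact zero_le
    _ ≤ ∫⁻ x, ∫⁻ z in Metric.ball 0 (2 * R), ENNReal.ofReal ((f (x + z) - f x) ^ 2) :=
        setLIntegral_le_lintegral _ _
    _ = ∫⁻ z in Metric.ball 0 (2 * R), ∫⁻ x, ENNReal.ofReal ((f (x + z) - f x) ^ 2) := by
        refine lintegral_lintegral_swap (Measurable.aemeasurable ?_)
        refine Measurable.ennreal_ofReal (Continuous.measurable ?_)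
        fun_prop
    _ ≤ ∫⁻ z in Metric.ball (0 : R3) (2 * R),
          ENNReal.ofReal ((2 * R) ^ 2 * ∫ x, ∑ i, pd i f x ^ 2) := by
        refine setLIntegral_mono' Metric.isOpen_ball.measurableSet fun z hz => ?_
        refine (lintegral_sq_sub_translate_le hf hE z).trans (ENNReal.ofReal_le_ofReal ?_)
        have hz' : ‖z‖ ≤ 2 * R := (mem_ball_zero_iff.1 hz).le
        gcongr
    _ = _ := by
        rw [setLIntegral_const, ENNReal.ofReal_mul measureReal_nonneg, ofReal_measureReal,
          mul_comm]

/-- A weighted Poincaré inequality on balls. -/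
lemma sq_integral_mul_integral_sq_le {f w : R3 → ℝ} (hf : ContDiff ℝ 1 f)
    (hE : Integrable fun x => ∑ i, pd i f x ^ 2) {R A : ℝ} (hR : 0 < R) (hw : Continuous w)
    (hw0 : ∀ x ∉ Metric.ball (0 : R3) R, w x = 0) (hwA : ∀ x, |w x| ≤ A) :
    (∫ x, w x) ^ 2 * ∫ x in Metric.ball 0 R, f x ^ 2 ≤
      2 * A ^ 2 * volume.real (Metric.ball (0 : R3) R) *
        (volume.real (Metric.ball (0 : R3) (2 * R)) * ((2 * R) ^ 2 * ∫ x, ∑ i, pd i f x ^ 2))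
      + 2 * volume.real (Metric.ball (0 : R3) R) * (∫ x, f x * w x) ^ 2 := by
  have hfc := hf.continuous
  set V := volume.real (Metric.ball (0 : R3) R)
  have hset : ∀ g : R3 → ℝ, ∫ x, g x * w x = ∫ x in Metric.ball 0 R, g x * w x := fun g =>
    (setIntegral_eq_integral_of_forall_compl_eq_zero fun x hx => by rw [hw0 x hx, mul_zero]).symm
  have hW : ∫ x, w x = ∫ x in Metric.ball 0 R, w x := by simpa using hset fun _ => 1
  have hJ : ∀ x, (∫ x, w x) ^ 2 * f x ^ 2 ≤
      2 * A ^ 2 * V * (∫ y in Metric.ball 0 R, (f x - f y) ^ 2) + 2 * (∫ x, f x * w x) ^ 2 := by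
    intro x
    have h1 : (∫ y, w y) * f x =
        (∫ y in Metric.ball 0 R, w y * (f x - f y)) + ∫ y, f y * w y := by
      rw [hset f, hW, ← integral_add (integrableOn_ball_of_continuous (by fun_prop) R)
        (integrableOn_ball_of_continuous (by fun_prop) R), ← integral_mul_const]
      refine integral_congr_ae (Filter.Eventually.of_forall fun y => ?_)
      simp only
      ring
    have h2 : (∫ y in Metric.ball 0 R, w y * (f x - f y)) ^ 2 ≤
        A ^ 2 * V * ∫ y in Metric.ball 0 R, (f x - f y) ^ 2 := by
      refine (sq_integral_mul_le (integrableOn_ball_of_continuous (by fun_prop) R)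
        (integrableOn_ball_of_continuous (by fun_prop) R)
        (integrableOn_ball_of_continuous (by fun_prop) R)).trans ?_
      refine mul_le_mul_of_nonneg_right ?_ (integral_nonneg fun y => sq_nonneg _)
      calc ∫ y in Metric.ball 0 R, w y ^ 2 ≤ ∫ y in Metric.ball (0 : R3) R, A ^ 2 :=
            integral_mono (integrableOn_ball_of_continuous (by fun_prop) R)
              (integrableOn_ball_of_continuous (by fun_prop) R)
              fun y => sq_le_sq' (by linarith [neg_abs_le (w y), hwA y])
                ((le_abs_self _).trans (hwA y))
        _ = A ^ 2 * V := by
            rw [setIntegral_const, smul_eq_mul, mul_comm]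
    rw [← mul_pow, h1]
    nlinarith [sq_nonneg ((∫ y in Metric.ball 0 R, w y * (f x - f y)) - ∫ y, f y * w y)]
  have hcJ : Continuous fun x => ∫ y in Metric.ball 0 R, (f x - f y) ^ 2 := by
    have : (fun x => ∫ y in Metric.ball 0 R, (f x - f y) ^ 2) = fun x =>
        f x ^ 2 * V - 2 * f x * (∫ y in Metric.ball 0 R, f y)
          + ∫ y in Metric.ball 0 R, f y ^ 2 := by
      funext x
      have i1 := integrableOn_ball_of_continuous (f := fun _ => f x ^ 2) (by fun_prop) R
      have i2 := integrableOn_ball_of_continuous (f := fun y => 2 * f x * f y) (by fun_prop) R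
      have i3 := integrableOn_ball_of_continuous (f := fun y => f y ^ 2) (by fun_prop) R
      rw [← integral_const_mul, mul_comm (f x ^ 2), ← smul_eq_mul V, ← setIntegral_const,
        ← integral_sub i1 i2]
      have i4 : IntegrableOn (fun y => f x ^ 2 - 2 * f x * f y) (Metric.ball 0 R) := i1.sub i2
      rw [← integral_add i4 i3]
      refine integral_congr_ae (Filter.Eventually.of_forall fun y => ?_)
      ring
    rw [this]
    fun_prop
  have i1 := integrableOn_ball_of_continuous (f := fun x =>
    2 * A ^ 2 * V * (∫ y in Metric.ball 0 R, (f x - f y) ^ 2)) (by fun_prop) R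
  have i2 := integrableOn_ball_of_continuous (f := fun _ => 2 * (∫ x, f x * w x) ^ 2)
    (by fun_prop) R
  calc (∫ x, w x) ^ 2 * ∫ x in Metric.ball 0 R, f x ^ 2
      = ∫ x in Metric.ball 0 R, (∫ x, w x) ^ 2 * f x ^ 2 := (integral_const_mul _ _).symm
    _ ≤ ∫ x in Metric.ball 0 R, (2 * A ^ 2 * V * (∫ y in Metric.ball 0 R, (f x - f y) ^ 2)
          + 2 * (∫ x, f x * w x) ^ 2) :=
        integral_mono (integrableOn_ball_of_continuous (by fun_prop) R)
          (integrableOn_ball_of_continuous (by fun_prop) R) hJ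
    _ = 2 * A ^ 2 * V * (∫ x in Metric.ball 0 R, ∫ y in Metric.ball 0 R, (f x - f y) ^ 2)
          + 2 * V * (∫ x, f x * w x) ^ 2 := by
        rw [integral_add i1 i2, integral_const_mul, setIntegral_const, smul_eq_mul]
        ring
    _ ≤ _ := by
        gcongr
        exact integral_integral_sq_sub_le hf hE hR

/-! ### Cutoff functions -/

lemma hasDerivAt_max_zero_sq (t : ℝ) : HasDerivAt (fun t : ℝ => max 0 t ^ 2) (2 * max 0 t) t := by
  rcases lt_trichotomy t 0 with h | rfl | h
  · rw [max_eq_left h.le, mul_zero]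
    refine (hasDerivAt_const t (0 : ℝ)).congr_of_eventuallyEq ?_
    filter_upwards [eventually_lt_nhds h] with s hs
    simp [max_eq_left hs.le]
  · simp only [max_self, mul_zero]
    rw [hasDerivAt_iff_isLittleO_nhds_zero]
    simp only [zero_add, max_self, smul_zero, sub_zero, ne_eq, OfNat.ofNat_ne_zero,
      not_false_eq_true, zero_pow]
    refine Asymptotics.IsBigO.trans_isLittleO (g := fun t : ℝ => t ^ 2) ?_
      (Asymptotics.isLittleO_pow_id one_lt_two)
    refine Asymptotics.IsBigO.of_bound 1 (Filter.Eventually.of_forall fun t => ?_)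
    rw [one_mul, norm_pow, norm_pow]
    gcongr
    rw [Real.norm_eq_abs, Real.norm_eq_abs, abs_of_nonneg (le_max_left _ _)]
    exact max_le (abs_nonneg _) (le_abs_self _)
  · rw [max_eq_right h.le]
    have : HasDerivAt (fun t : ℝ => t ^ 2) (2 * t) t := by simpa using hasDerivAt_pow 2 t
    refine this.congr_of_eventuallyEq ?_
    filter_upwards [eventually_gt_nhds h] with s hs
    simp [max_eq_right hs.le]

lemma contDiff_max_zero_sq : ContDiff ℝ 1 (fun t : ℝ => max 0 t ^ 2) := by
  rw [contDiff_one_iff_deriv]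
  refine ⟨fun t => (hasDerivAt_max_zero_sq t).differentiableAt, ?_⟩
  rw [show deriv (fun t : ℝ => max 0 t ^ 2) = fun t => 2 * max 0 t from
    funext fun t => (hasDerivAt_max_zero_sq t).deriv]
  fun_prop

/-- The truncated profile `(1 - |x|⁴/R⁴)₊`. -/
def trunc (R : ℝ) (x : R3) : ℝ := max 0 (1 - (‖x‖ ^ 2) ^ 2 / R ^ 4)

lemma trunc_nonneg (R : ℝ) (x : R3) : 0 ≤ trunc R x := le_max_left _ _

lemma trunc_le_one (R : ℝ) (x : R3) : trunc R x ≤ 1 :=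
  max_le zero_le_one (sub_le_self _ (by positivity))

lemma le_trunc (R : ℝ) (x : R3) : 1 - (‖x‖ ^ 2) ^ 2 / R ^ 4 ≤ trunc R x := le_max_right _ _

lemma trunc_eq_zero {R : ℝ} (hR : 0 < R) {x : R3} (hx : x ∉ Metric.ball (0 : R3) R) :
    trunc R x = 0 := by
  have h : R ≤ ‖x‖ := by simpa using hx
  refine max_eq_left ?_
  rw [sub_nonpos, one_le_div (by positivity), ← pow_mul]
  gcongr

lemma contDiff_trunc_sq (R : ℝ) : ContDiff ℝ 1 (fun x => trunc R x ^ 2) :=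
  contDiff_max_zero_sq.comp
    (contDiff_const.sub (((contDiff_norm_sq ℝ).pow 2).div_const _))

lemma hasCompactSupport_trunc_sq {R : ℝ} (hR : 0 < R) :
    HasCompactSupport (fun x => trunc R x ^ 2) := by
  refine HasCompactSupport.intro (isCompact_closedBall (0 : R3) R) fun x hx => ?_
  rw [trunc_eq_zero hR fun h => hx (Metric.ball_subset_closedBall h)]
  norm_num

lemma pd_trunc_sq (R : ℝ) (i : Fin 3) (x : R3) :
    pd i (fun x => trunc R x ^ 2) x = -(8 * ‖x‖ ^ 2 * trunc R x / R ^ 4) * x i := by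
  have hn : ContDiff ℝ 1 (fun y : R3 => ‖y‖ ^ 2) := contDiff_norm_sq ℝ
  have hn1 : DifferentiableAt ℝ (fun y : R3 => ‖y‖ ^ 2) x := hn.differentiable (by norm_num) x
  have hn2 : DifferentiableAt ℝ (fun y : R3 => (R ^ 4)⁻¹ * (‖y‖ ^ 2) ^ 2) x :=
    (hn1.pow 2).const_mul _
  have e : ∀ y : R3, 1 - (‖y‖ ^ 2) ^ 2 / R ^ 4 = 1 - (R ^ 4)⁻¹ * (‖y‖ ^ 2) ^ 2 := fun y => by ring
  have h1 : DifferentiableAt ℝ (fun y : R3 => 1 - (R ^ 4)⁻¹ * (‖y‖ ^ 2) ^ 2) x :=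
    (differentiableAt_const _).sub hn2
  have h2 : pd i (fun y : R3 => 1 - (R ^ 4)⁻¹ * (‖y‖ ^ 2) ^ 2) x
      = -(4 * ‖x‖ ^ 2 * x i / R ^ 4) := by
    rw [pd_sub i (differentiableAt_const _) hn2, pd_const_mul (f := fun y : R3 => (‖y‖ ^ 2) ^ 2) i _ (hn1.pow 2),
      pd_const,
      pd_comp (f := fun y : R3 => ‖y‖ ^ 2) i (hasDerivAt_pow 2 (‖x‖ ^ 2)) hn1, pd_norm_sq]
    push_cast
    ring
  have h3 := pd_comp (f := fun y : R3 => 1 - (R ^ 4)⁻¹ * (‖y‖ ^ 2) ^ 2) i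
    (hasDerivAt_max_zero_sq _) h1
  simp only [trunc, e]
  rw [h3, h2]
  ring

/-! ### Decay at infinity of finite-energy solutions -/

/-- The radial solution `(1 - |x|²) (1 + |x|²)^(-3/2)` of the linearized equation. -/
def radialKer (x : R3) : ℝ := 2 * (jb x ^ 3)⁻¹ - (jb x ^ 1)⁻¹

lemma contDiff_radialKer {n : WithTop ℕ∞} : ContDiff ℝ n radialKer :=
  (contDiff_const.mul (contDiff_jb_pow_inv 3)).sub (contDiff_jb_pow_inv 1)

lemma pd_radialKer (i : Fin 3) (x : R3) :
    pd i radialKer x = (jb x ^ 2 - 6) * (jb x ^ 5)⁻¹ * x i := by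
  have h0 := (jb_pos x).ne'
  have hd : ∀ n, DifferentiableAt ℝ (fun y => (jb y ^ n)⁻¹) x := fun n =>
    (contDiff_jb_pow_inv (m := 1) n).differentiable (by norm_num) x
  change pd i (fun x => 2 * (jb x ^ 3)⁻¹ - (jb x ^ 1)⁻¹) x = _
  rw [pd_sub i ((hd 3).const_mul 2) (hd 1), pd_const_mul i _ (hd 3), pd_jb_pow_inv, pd_jb_pow_inv]
  field_simp
  push_cast
  ring

lemma lap_radialKer (x : R3) : lap radialKer x = -(15 * radialKer x / jb x ^ 4) := by
  have h0 := (jb_pos x).ne'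
  have h2 : ∀ i, pd i (pd i radialKer) x =
      (jb x ^ 2 - 6) * (jb x ^ 5)⁻¹ + x i ^ 2 * (30 * (jb x ^ 7)⁻¹ - 3 * (jb x ^ 5)⁻¹) := by
    intro i
    have hd : ∀ n, DifferentiableAt ℝ (fun y => (jb y ^ n)⁻¹) x := fun n =>
      (contDiff_jb_pow_inv (m := 1) n).differentiable (by norm_num) x
    have hd3 := hd 3
    have hd5 := hd 5
    have hxi := differentiable_coord i
    have h1 : pd i radialKer = fun x => ((jb x ^ 3)⁻¹ - 6 * (jb x ^ 5)⁻¹) * x i := by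
      funext y
      have h0 := (jb_pos y).ne'
      rw [pd_radialKer]
      field_simp
    rw [h1, pd_mul i (by fun_prop) (by fun_prop), pd_sub i hd3 (by fun_prop),
      pd_const_mul i _ hd5, pd_jb_pow_inv, pd_jb_pow_inv, pd_coord]
    simp
    field_simp
    ring
  have hs := jb_sq_sum x
  simp only [lap_eq_sum_pd, h2, Fin.sum_univ_three, radialKer] at hs ⊢
  have e : x 2 ^ 2 = jb x ^ 2 - 1 - x 0 ^ 2 - x 1 ^ 2 := by linarith
  rw [e]
  field_simp
  ring

lemma abs_radialKer_le (x : R3) : |radialKer x| ≤ (jb x)⁻¹ := by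
  have h0 := jb_pos x
  have h1 : radialKer x = (2 * (jb x ^ 2)⁻¹ - 1) * (jb x)⁻¹ := by
    unfold radialKer
    field_simp
  have h2 : (jb x ^ 2)⁻¹ ≤ 1 := inv_le_one_of_one_le₀ (one_le_pow₀ (one_le_jb x))
  have h3 : 0 < (jb x ^ 2)⁻¹ := by positivity
  rw [h1, abs_mul, abs_of_pos (inv_pos.2 h0)]
  refine mul_le_of_le_one_left (by positivity) (abs_le.2 ⟨by linarith, by linarith⟩)

/-- The flux weight `-∇(radialKer) · ∇(trunc²)`. -/
def fluxWeight (R : ℝ) (x : R3) : ℝ := -∑ i, pd i radialKer x * pd i (fun x => trunc R x ^ 2) x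

lemma fluxWeight_eq (R : ℝ) (x : R3) :
    fluxWeight R x = 8 * ‖x‖ ^ 4 * trunc R x * (jb x ^ 2 - 6) * (jb x ^ 5)⁻¹ / R ^ 4 := by
  have h : ‖x‖ ^ 2 = ∑ i, x i ^ 2 := EuclideanSpace.real_norm_sq_eq x
  simp only [fluxWeight, pd_radialKer, pd_trunc_sq]
  simp only [Fin.sum_univ_three] at h ⊢
  rw [show ‖x‖ ^ 4 = ‖x‖ ^ 2 * (x 0 ^ 2 + x 1 ^ 2 + x 2 ^ 2) by rw [← h]; ring]
  ring

lemma continuous_fluxWeight (R : ℝ) : Continuous (fluxWeight R) :=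
  (continuous_finsetSum _ fun i _ => (continuous_pd contDiff_radialKer i).mul
    (continuous_pd (contDiff_trunc_sq R) i)).neg

lemma fluxWeight_eq_zero {R : ℝ} (hR : 0 < R) {x : R3} (hx : x ∉ Metric.ball (0 : R3) R) :
    fluxWeight R x = 0 := by
  rw [fluxWeight_eq, trunc_eq_zero hR hx]
  simp

lemma abs_fluxWeight_le_norm {R : ℝ} (hR : 0 < R) (x : R3) :
    |fluxWeight R x| ≤ 40 * ‖x‖ / R ^ 4 := by
  have h0 := jb_pos x
  have h1 := one_le_jb x
  have h5 : |jb x ^ 2 - 6| ≤ 5 * jb x ^ 2 := abs_le.2 ⟨by nlinarith, by nlinarith⟩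
  rw [fluxWeight_eq, abs_div, abs_of_pos (by positivity : 0 < R ^ 4)]
  refine div_le_div_of_nonneg_right ?_ (by positivity)
  rw [abs_mul, abs_mul, abs_mul, abs_of_nonneg (trunc_nonneg R x),
    abs_of_nonneg (by positivity : 0 ≤ 8 * ‖x‖ ^ 4),
    abs_of_pos (by positivity : 0 < (jb x ^ 5)⁻¹)]
  calc 8 * ‖x‖ ^ 4 * trunc R x * |jb x ^ 2 - 6| * (jb x ^ 5)⁻¹
      ≤ 8 * ‖x‖ ^ 4 * 1 * (5 * jb x ^ 2) * (jb x ^ 5)⁻¹ := by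
        gcongr
        exact trunc_le_one R x
    _ = 40 * ‖x‖ * (‖x‖ ^ 3 / jb x ^ 3) := by field_simp; ring
    _ ≤ 40 * ‖x‖ * 1 := by
        gcongr
        rw [div_le_one (by positivity)]
        gcongr
        exact norm_le_jb x
    _ = 40 * ‖x‖ := mul_one _

lemma abs_fluxWeight_le {R : ℝ} (hR : 0 < R) (x : R3) : |fluxWeight R x| ≤ 40 / R ^ 3 := by
  by_cases hx : x ∈ Metric.ball (0 : R3) R
  · refine (abs_fluxWeight_le_norm hR x).trans ?_
    have : ‖x‖ ≤ R := (mem_ball_zero_iff.1 hx).le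
    calc 40 * ‖x‖ / R ^ 4 ≤ 40 * R / R ^ 4 := by gcongr
      _ = 40 / R ^ 3 := by field_simp
  · rw [fluxWeight_eq_zero hR hx, abs_zero]
    positivity

lemma le_fluxWeight {R : ℝ} (hR : 32 ≤ R) (x : R3) :
    1 / (8 * R ^ 3) * ((Metric.ball (0 : R3) (3 / 4 * R)).indicator (fun _ => 1) x
      - (Metric.ball (0 : R3) (1 / 2 * R)).indicator (fun _ => 1) x)
      - 120 / R ^ 4 * (Metric.ball (0 : R3) 3).indicator (fun _ => 1) x ≤ fluxWeight R x := by
  have hR0 : 0 < R := by linarith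
  have h0 := jb_pos x
  have hs := jb_sq x
  have hn := norm_nonneg x
  by_cases h3 : ‖x‖ < 3
  · have e1 : x ∈ Metric.ball (0 : R3) (3 / 4 * R) := mem_ball_zero_iff.2 (by linarith)
    have e2 : x ∈ Metric.ball (0 : R3) (1 / 2 * R) := mem_ball_zero_iff.2 (by linarith)
    have e3 : x ∈ Metric.ball (0 : R3) 3 := mem_ball_zero_iff.2 h3
    rw [Set.indicator_of_mem e1, Set.indicator_of_mem e2, Set.indicator_of_mem e3]
    have h := (abs_le.1 (abs_fluxWeight_le_norm hR0 x)).1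
    have : 40 * ‖x‖ / R ^ 4 ≤ 120 / R ^ 4 := by gcongr; linarith
    linarith
  · push Not at h3
    have e3 : x ∉ Metric.ball (0 : R3) 3 := by simpa using h3
    rw [Set.indicator_of_notMem e3]
    have hpos : 0 ≤ fluxWeight R x := by
      rw [fluxWeight_eq]
      have : 0 ≤ jb x ^ 2 - 6 := by nlinarith
      have := trunc_nonneg R x
      positivity
    by_cases h2 : ‖x‖ < 1 / 2 * R
    · have e1 : x ∈ Metric.ball (0 : R3) (3 / 4 * R) := mem_ball_zero_iff.2 (by linarith)
      have e2 : x ∈ Metric.ball (0 : R3) (1 / 2 * R) := mem_ball_zero_iff.2 h2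
      rw [Set.indicator_of_mem e1, Set.indicator_of_mem e2]
      linarith
    push Not at h2
    have e2 : x ∉ Metric.ball (0 : R3) (1 / 2 * R) := by simpa using h2
    rw [Set.indicator_of_notMem e2]
    by_cases h1 : ‖x‖ < 3 / 4 * R
    · have e1 : x ∈ Metric.ball (0 : R3) (3 / 4 * R) := mem_ball_zero_iff.2 h1
      rw [Set.indicator_of_mem e1]
      have ht : 1 / 2 ≤ trunc R x := by
        refine le_trans ?_ (le_trunc R x)
        have : (‖x‖ ^ 2) ^ 2 / R ^ 4 ≤ 1 / 2 := by
          rw [div_le_iff₀ (by positivity), ← pow_mul]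
          calc ‖x‖ ^ 4 ≤ (3 / 4 * R) ^ 4 := by gcongr
            _ = (81 / 256) * R ^ 4 := by ring
            _ ≤ 1 / 2 * R ^ 4 := mul_le_mul_of_nonneg_right (by norm_num) (by positivity)
        linarith
      have hj : jb x ≤ 2 * ‖x‖ := by nlinarith
      have hj6 : jb x ^ 2 / 2 ≤ jb x ^ 2 - 6 := by nlinarith
      rw [fluxWeight_eq]
      calc 1 / (8 * R ^ 3) * (1 - 0) - 120 / R ^ 4 * 0
          = 8 * (1 / 2 * R) * (1 / 2) * (1 / 2) * (1 / 8) / R ^ 4 := by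
            field_simp
            norm_num
            ring
        _ ≤ 8 * ‖x‖ * trunc R x * (1 / 2) * (‖x‖ ^ 3 / jb x ^ 3) / R ^ 4 := by
            have : 1 / 8 ≤ ‖x‖ ^ 3 / jb x ^ 3 := by
              rw [le_div_iff₀ (by positivity)]
              calc 1 / 8 * jb x ^ 3 ≤ 1 / 8 * (2 * ‖x‖) ^ 3 := by gcongr
                _ = ‖x‖ ^ 3 := by ring
            gcongr
        _ = 8 * ‖x‖ ^ 4 * trunc R x * (jb x ^ 2 / 2) * (jb x ^ 5)⁻¹ / R ^ 4 := by
            field_simp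
        _ ≤ 8 * ‖x‖ ^ 4 * trunc R x * (jb x ^ 2 - 6) * (jb x ^ 5)⁻¹ / R ^ 4 := by
            have := trunc_nonneg R x
            gcongr
    · have e1 : x ∉ Metric.ball (0 : R3) (3 / 4 * R) := by simpa using h1
      rw [Set.indicator_of_notMem e1]
      linarith

lemma le_integral_fluxWeight {R : ℝ} (hR : 32 ≤ R) :
    volume.real (Metric.ball (0 : R3) 1) / 64 ≤ ∫ x, fluxWeight R x := by
  have hR0 : 0 < R := by linarith
  set v := volume.real (Metric.ball (0 : R3) 1)
  have hv : 0 ≤ v := measureReal_nonneg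
  have hind : ∀ r : ℝ, Integrable ((Metric.ball (0 : R3) r).indicator fun _ => (1 : ℝ)) :=
    fun r => (integrable_indicator_iff Metric.isOpen_ball.measurableSet).2
      (integrableOn_ball_of_continuous continuous_const r)
  have hval : ∀ r : ℝ, 0 < r →
      ∫ x, (Metric.ball (0 : R3) r).indicator (fun _ => (1 : ℝ)) x = r ^ 3 * v := by
    intro r hr
    rw [integral_indicator Metric.isOpen_ball.measurableSet, setIntegral_const, smul_eq_mul,
      mul_one, volume_real_ball hr]
  have hwi : Integrable (fluxWeight R) :=
    (continuous_fluxWeight R).integrable_of_hasCompactSupport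
      (HasCompactSupport.intro (isCompact_closedBall (0 : R3) R) fun x hx =>
        fluxWeight_eq_zero hR0 fun h => hx (Metric.ball_subset_closedBall h))
  have i1 : Integrable fun x => 1 / (8 * R ^ 3) *
      ((Metric.ball (0 : R3) (3 / 4 * R)).indicator (fun _ => (1 : ℝ)) x
      - (Metric.ball (0 : R3) (1 / 2 * R)).indicator (fun _ => 1) x) :=
    ((hind _).sub (hind _)).const_mul _
  have i2 : Integrable fun x =>
      120 / R ^ 4 * (Metric.ball (0 : R3) 3).indicator (fun _ => (1 : ℝ)) x :=
    (hind 3).const_mul _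
  have h := integral_mono (i1.sub i2) hwi (le_fluxWeight hR)
  simp only [Pi.sub_apply] at h
  rw [integral_sub i1 i2, integral_const_mul, integral_const_mul, integral_sub (hind _) (hind _),
    hval _ (by positivity), hval _ (by positivity), hval _ (by norm_num)] at h
  refine le_trans ?_ h
  have e : 1 / (8 * R ^ 3) * ((3 / 4 * R) ^ 3 * v - (1 / 2 * R) ^ 3 * v)
      - 120 / R ^ 4 * (3 ^ 3 * v) = v * (19 / 512 - 3240 / R ^ 4) := by
    field_simp
    ring
  rw [e]
  have h4 : (32 : ℝ) ^ 4 ≤ R ^ 4 := by gcongr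
  have h5 : 3240 / R ^ 4 ≤ 3240 / 32 ^ 4 := by gcongr
  have h6 : (3240 : ℝ) / 32 ^ 4 ≤ 1 / 64 := by norm_num
  rw [div_eq_mul_one_div]
  gcongr
  linarith

lemma integral_mul_fluxWeight {φ : R3 → ℝ} (hφ : ContDiff ℝ 2 φ)
    (hker : ∀ x, lap φ x = -(15 * φ x / jb x ^ 4)) {R : ℝ} (hR : 0 < R) :
    ∫ x, φ x * fluxWeight R x =
      -∑ i, ∫ x, pd i φ x * (radialKer x * pd i (fun x => trunc R x ^ 2) x) := by
  set χ : R3 → ℝ := fun x => trunc R x ^ 2 with hχdef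
  have hχ : ContDiff ℝ 1 χ := contDiff_trunc_sq R
  have hχc : HasCompactSupport χ := hasCompactSupport_trunc_sq hR
  have hφ1 : ContDiff ℝ 1 φ := hφ.of_le (by norm_num)
  have hZ1 : ContDiff ℝ 1 radialKer := contDiff_radialKer
  have hZ2 : ContDiff ℝ 2 radialKer := contDiff_radialKer
  have cφ := hφ.continuous
  have cZ := hZ1.continuous
  have cχ := hχ.continuous
  have cφi := continuous_pd hφ1
  have cZi := continuous_pd hZ1
  have cχi := continuous_pd hχ
  have cφii : ∀ i, Continuous (pd i (pd i φ)) := fun i => continuous_pd (contDiff_pd hφ i) i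
  have cZii : ∀ i, Continuous (pd i (pd i radialKer)) :=
    fun i => continuous_pd (contDiff_pd hZ2 i) i
  have int0 : ∀ {f g : R3 → ℝ}, Continuous f → Continuous g →
      Integrable fun x => f x * g x * χ x := fun hf hg =>
    ((hf.mul hg).mul cχ).integrable_of_hasCompactSupport hχc.mul_left
  have int1 : ∀ {f g : R3 → ℝ} (i), Continuous f → Continuous g →
      Integrable fun x => f x * g x * pd i χ x := fun i hf hg =>
    ((hf.mul hg).mul (cχi i)).integrable_of_hasCompactSupport (hχc.pd i).mul_left
  have hA : ∀ {f g : R3 → ℝ}, ContDiff ℝ 2 f → ContDiff ℝ 1 g → ∀ i,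
      ∫ x, pd i (pd i f) x * g x * χ x =
        -((∫ x, pd i f x * g x * pd i χ x) + ∫ x, pd i f x * pd i g x * χ x) := by
    intro f g hf hg i
    have h := integral_pd_mul (contDiff_pd hf i) (hg.mul hχ) hχc.mul_left i
    have e : ∀ x, pd i (fun y => g y * χ y) x = pd i g x * χ x + g x * pd i χ x := fun x =>
      pd_mul i (hg.differentiable (by norm_num) x) (hχ.differentiable (by norm_num) x)
    have cf := continuous_pd (hf.of_le (by norm_num) : ContDiff ℝ 1 f) i
    rw [← integral_add (int1 i cf hg.continuous) (int0 cf (continuous_pd hg i))]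
    simp only [mul_assoc] at h ⊢
    rw [h]
    simp only [e]
    congr 2
    funext x
    ring
  have hz : ∑ i, ((∫ x, pd i (pd i radialKer) x * φ x * χ x)
      - ∫ x, pd i (pd i φ) x * radialKer x * χ x) = 0 := by
    rw [Finset.sum_sub_distrib,
      ← integral_finsetSum _ fun i _ => int0 (cZii i) cφ,
      ← integral_finsetSum _ fun i _ => int0 (cφii i) cZ, sub_eq_zero]
    congr 1
    funext x
    have h1 := lap_radialKer x
    have h2 := hker x
    rw [lap_eq_sum_pd] at h1 h2
    simp only [← Finset.sum_mul]
    rw [h1, h2]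
    ring
  have hl : ∫ x, φ x * fluxWeight R x = -∑ i, ∫ x, pd i radialKer x * φ x * pd i χ x := by
    rw [← integral_finsetSum _ fun i _ => int1 i (cZi i) cφ, ← integral_neg]
    congr 1
    funext x
    simp only [fluxWeight, Finset.mul_sum, mul_neg]
    congr 1
    exact Finset.sum_congr rfl fun i _ => by ring
  rw [hl, neg_inj, ← sub_eq_zero, ← Finset.sum_sub_distrib, ← neg_eq_zero, ← hz,
    ← Finset.sum_neg_distrib]
  refine Finset.sum_congr rfl fun i _ => ?_
  rw [hA hZ2 hφ1 i, hA hφ hZ1 i]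
  have e1 : ∫ x, pd i radialKer x * pd i φ x * χ x = ∫ x, pd i φ x * pd i radialKer x * χ x := by
    congr 1
    funext x
    ring
  have e2 : ∫ x, pd i φ x * (radialKer x * pd i χ x) = ∫ x, pd i φ x * radialKer x * pd i χ x := by
    simp only [mul_assoc]
  rw [e1, e2]
  ring

lemma abs_pd_trunc_sq_le {R : ℝ} (hR : 0 < R) (i : Fin 3) (x : R3) :
    |pd i (fun x => trunc R x ^ 2) x| ≤ 8 * ‖x‖ ^ 3 * trunc R x / R ^ 4 := by
  have ht := trunc_nonneg R x
  have hi : |x i| ≤ ‖x‖ := by simpa using PiLp.norm_apply_le x i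
  rw [pd_trunc_sq, abs_mul, abs_neg, abs_of_nonneg (by positivity)]
  calc 8 * ‖x‖ ^ 2 * trunc R x / R ^ 4 * |x i| ≤ 8 * ‖x‖ ^ 2 * trunc R x / R ^ 4 * ‖x‖ := by
        gcongr
    _ = 8 * ‖x‖ ^ 3 * trunc R x / R ^ 4 := by ring

lemma sq_integral_mul_fluxWeight_le {φ : R3 → ℝ} (hφ : ContDiff ℝ 2 φ)
    (hker : ∀ x, lap φ x = -(15 * φ x / jb x ^ 4))
    (hE : Integrable fun x => ∑ i, pd i φ x ^ 2) {R : ℝ} (hR : 0 < R) :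
    (∫ x, φ x * fluxWeight R x) ^ 2 ≤
      192 * volume.real (Metric.ball (0 : R3) 1) * (∫ x, ∑ i, pd i φ x ^ 2) / R := by
  set v := volume.real (Metric.ball (0 : R3) 1)
  set χ : R3 → ℝ := fun x => trunc R x ^ 2 with hχdef
  have hχ : ContDiff ℝ 1 χ := contDiff_trunc_sq R
  have hχc : HasCompactSupport χ := hasCompactSupport_trunc_sq hR
  have hφ1 : ContDiff ℝ 1 φ := hφ.of_le (by norm_num)
  have cZ : Continuous radialKer := (contDiff_radialKer (n := 1)).continuous
  have cφi := continuous_pd hφ1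
  have cχi := continuous_pd hχ
  have hEi : ∀ i, Integrable fun x => pd i φ x ^ 2 := fun i =>
    hE.mono' ((cφi i).pow 2).aestronglyMeasurable (Filter.Eventually.of_forall fun x => by
      rw [Real.norm_eq_abs, abs_of_nonneg (sq_nonneg _)]
      exact Finset.single_le_sum (f := fun i => pd i φ x ^ 2) (fun j _ => sq_nonneg _)
        (Finset.mem_univ i))
  have hk : ∀ i x, (radialKer x * pd i χ x) ^ 2 ≤
      (Metric.ball (0 : R3) R).indicator (fun _ => 64 / R ^ 4) x := by
    intro i x
    have h0 := jb_pos x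
    by_cases hx : x ∈ Metric.ball (0 : R3) R
    · have hxR := (mem_ball_zero_iff.1 hx).le
      rw [Set.indicator_of_mem hx]
      have h1 : |radialKer x * pd i χ x| ≤ 8 / R ^ 2 := by
        rw [abs_mul]
        calc |radialKer x| * |pd i χ x|
            ≤ (jb x)⁻¹ * (8 * ‖x‖ ^ 3 * trunc R x / R ^ 4) := by
              gcongr
              · exact abs_radialKer_le x
              · exact abs_pd_trunc_sq_le hR i x
          _ ≤ (jb x)⁻¹ * (8 * (R ^ 2 * jb x) * 1 / R ^ 4) := by
              have := trunc_nonneg R x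
              have h3 : ‖x‖ ^ 3 ≤ R ^ 2 * jb x := by
                rw [pow_succ]
                gcongr
                exact norm_le_jb x
              gcongr
              exact trunc_le_one R x
          _ = 8 / R ^ 2 := by field_simp
      calc (radialKer x * pd i χ x) ^ 2 = |radialKer x * pd i χ x| ^ 2 := (sq_abs _).symm
        _ ≤ (8 / R ^ 2) ^ 2 := by gcongr
        _ = 64 / R ^ 4 := by ring
    · rw [Set.indicator_of_notMem hx, pd_trunc_sq, trunc_eq_zero hR hx]
      simp
  have hki : Integrable ((Metric.ball (0 : R3) R).indicator fun _ => 64 / R ^ 4) :=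
    (integrable_indicator_iff Metric.isOpen_ball.measurableSet).2
      (integrableOn_ball_of_continuous continuous_const R)
  have hkc : ∀ i, Continuous fun x => radialKer x * pd i χ x := fun i => cZ.mul (cχi i)
  have hks : ∀ i, HasCompactSupport fun x => radialKer x * pd i χ x :=
    fun i => (hχc.pd i).mul_left
  have hk2 : ∀ i, Integrable fun x => (radialKer x * pd i χ x) ^ 2 := fun i =>
    hki.mono' ((hkc i).pow 2).aestronglyMeasurable (Filter.Eventually.of_forall fun x => by
      rw [Real.norm_eq_abs, abs_of_nonneg (sq_nonneg _)]
      exact hk i x)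
  have hkint : ∀ i, ∫ x, (radialKer x * pd i χ x) ^ 2 ≤ 64 * v / R := by
    intro i
    refine (integral_mono (hk2 i) hki (hk i)).trans_eq ?_
    rw [integral_indicator Metric.isOpen_ball.measurableSet, setIntegral_const, smul_eq_mul,
      volume_real_ball hR]
    field_simp
    rfl
  have hm : ∀ i, (∫ x, pd i φ x * (radialKer x * pd i χ x)) ^ 2 ≤
      (∫ x, pd i φ x ^ 2) * (64 * v / R) := fun i =>
    (sq_integral_mul_le (hEi i) (hk2 i)
      (((cφi i).mul (hkc i)).integrable_of_hasCompactSupport (hks i).mul_left)).trans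
      (mul_le_mul_of_nonneg_left (hkint i) (integral_nonneg fun x => sq_nonneg _))
  rw [integral_mul_fluxWeight hφ hker hR, neg_sq, integral_finsetSum _ fun i _ => hEi i]
  calc (∑ i, ∫ x, pd i φ x * (radialKer x * pd i χ x)) ^ 2
      ≤ 3 * ∑ i, (∫ x, pd i φ x * (radialKer x * pd i χ x)) ^ 2 := by
        simpa using sq_sum_le_card_mul_sum_sq (s := Finset.univ)
          (f := fun i : Fin 3 => ∫ x, pd i φ x * (radialKer x * pd i χ x))
    _ ≤ 3 * ∑ i, (∫ x, pd i φ x ^ 2) * (64 * v / R) := by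
        gcongr with i
        exact hm i
    _ = 192 * v * (∑ i, ∫ x, pd i φ x ^ 2) / R := by
        rw [← Finset.sum_mul]
        ring

lemma integral_ball_sq_le {φ : R3 → ℝ} (hφ : ContDiff ℝ 2 φ)
    (hker : ∀ x, lap φ x = -(15 * φ x / jb x ^ 4))
    (hE : Integrable fun x => ∑ i, pd i φ x ^ 2) {R : ℝ} (hR : 32 ≤ R) :
    ∫ x in Metric.ball 0 R, φ x ^ 2 ≤ 4096 * 102784 * (∫ x, ∑ i, pd i φ x ^ 2) * R ^ 2 := by
  have hR0 : 0 < R := by linarith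
  set E := ∫ x, ∑ i, pd i φ x ^ 2
  set v := volume.real (Metric.ball (0 : R3) 1) with hvdef
  have hv : 0 < v := ENNReal.toReal_pos (Metric.measure_ball_pos volume 0 one_pos).ne'
    measure_ball_lt_top.ne
  have h1 := sq_integral_mul_integral_sq_le (hφ.of_le (by norm_num)) hE hR0
    (continuous_fluxWeight R) (fun x hx => fluxWeight_eq_zero hR0 hx) (abs_fluxWeight_le hR0)
  have h2 := le_integral_fluxWeight hR
  have h3 := sq_integral_mul_fluxWeight_le hφ hker hE hR0
  rw [volume_real_ball hR0, volume_real_ball (by positivity : 0 < 2 * R)] at h1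
  set J := ∫ x in Metric.ball 0 R, φ x ^ 2 with hJ
  have hJ0 : 0 ≤ J := integral_nonneg fun x => sq_nonneg _
  have h4 : (v / 64) ^ 2 * J ≤ (∫ x, fluxWeight R x) ^ 2 * J := by gcongr
  have h5 : (v / 64) ^ 2 * J ≤ v ^ 2 * (102784 * E * R ^ 2) := by
    refine h4.trans (h1.trans ?_)
    calc 2 * (40 / R ^ 3) ^ 2 * (R ^ 3 * v) * ((2 * R) ^ 3 * v * ((2 * R) ^ 2 * E))
          + 2 * (R ^ 3 * v) * (∫ x, φ x * fluxWeight R x) ^ 2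
        ≤ 2 * (40 / R ^ 3) ^ 2 * (R ^ 3 * v) * ((2 * R) ^ 3 * v * ((2 * R) ^ 2 * E))
          + 2 * (R ^ 3 * v) * (192 * v * E / R) := by gcongr
      _ = v ^ 2 * (102784 * E * R ^ 2) := by
          field_simp
          ring
  have h6 : v ^ 2 * (J / 4096) ≤ v ^ 2 * (102784 * E * R ^ 2) := by
    refine le_trans (le_of_eq ?_) h5
    ring
  have h7 := le_of_mul_le_mul_left h6 (by positivity)
  linarith

/-! ### Vanishing of the trace-free Hessian -/

lemma weighted_sum_sq_pd_le {φ : R3 → ℝ} (hφ : Differentiable ℝ φ) (x : R3) :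
    (jb x ^ 4)⁻¹ * ∑ i, pd i (fun y => jb y ^ 3 * φ y) x ^ 2 ≤
      18 * φ x ^ 2 + 2 * jb x ^ 2 * ∑ i, pd i φ x ^ 2 := by
  have h0 := jb_pos x
  have hs := jb_sq_sum x
  rw [inv_mul_le_iff₀ (by positivity)]
  have h1 : ∀ i, pd i (fun y => jb y ^ 3 * φ y) x ^ 2 ≤
      18 * (jb x * φ x) ^ 2 * x i ^ 2 + 2 * (jb x ^ 3) ^ 2 * pd i φ x ^ 2 := fun i => by
    rw [pd_jb_cube_mul hφ]
    nlinarith [sq_nonneg (3 * (jb x * (x i * φ x)) - jb x ^ 3 * pd i φ x)]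
  calc ∑ i, pd i (fun y => jb y ^ 3 * φ y) x ^ 2
      ≤ ∑ i, (18 * (jb x * φ x) ^ 2 * x i ^ 2 + 2 * (jb x ^ 3) ^ 2 * pd i φ x ^ 2) :=
        Finset.sum_le_sum fun i _ => h1 i
    _ = 18 * (jb x * φ x) ^ 2 * (jb x ^ 2 - 1) + 2 * (jb x ^ 3) ^ 2 * ∑ i, pd i φ x ^ 2 := by
        rw [Finset.sum_add_distrib, ← Finset.mul_sum, ← Finset.mul_sum, hs]
        ring
    _ ≤ 18 * (jb x * φ x) ^ 2 * jb x ^ 2 + 2 * (jb x ^ 3) ^ 2 * ∑ i, pd i φ x ^ 2 := by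
        gcongr
        linarith
    _ = jb x ^ 4 * (18 * φ x ^ 2 + 2 * jb x ^ 2 * ∑ i, pd i φ x ^ 2) := by ring

lemma integral_ball_weighted_sum_sq_pd_le {φ : R3 → ℝ} (hφ : ContDiff ℝ 2 φ)
    (hker : ∀ x, lap φ x = -(15 * φ x / jb x ^ 4))
    (hE : Integrable fun x => ∑ i, pd i φ x ^ 2) {R : ℝ} (hR : 32 ≤ R) :
    ∫ x in Metric.ball 0 R, (jb x ^ 4)⁻¹ * ∑ i, pd i (fun y => jb y ^ 3 * φ y) x ^ 2 ≤
      (18 * (4096 * 102784) + 4) * (∫ x, ∑ i, pd i φ x ^ 2) * R ^ 2 := by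
  have hφ1 : ContDiff ℝ 1 φ := hφ.of_le (by norm_num)
  have hF1 : ContDiff ℝ 1 (fun y => jb y ^ 3 * φ y) := (contDiff_jb.pow 3).mul hφ1
  have hcF : Continuous fun x => (jb x ^ 4)⁻¹ * ∑ i, pd i (fun y => jb y ^ 3 * φ y) x ^ 2 :=
    (contDiff_jb_pow_inv (m := 1) 4).continuous.mul
      (continuous_finsetSum _ fun i _ => (continuous_pd hF1 i).pow 2)
  have hi1 : IntegrableOn (fun x => 18 * φ x ^ 2) (Metric.ball 0 R) :=
    integrableOn_ball_of_continuous (by have := hφ.continuous; fun_prop) R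
  have hi2 : IntegrableOn (fun x => 4 * R ^ 2 * ∑ i, pd i φ x ^ 2) (Metric.ball 0 R) :=
    (hE.const_mul _).integrableOn
  calc ∫ x in Metric.ball 0 R, (jb x ^ 4)⁻¹ * ∑ i, pd i (fun y => jb y ^ 3 * φ y) x ^ 2
      ≤ ∫ x in Metric.ball 0 R, (18 * φ x ^ 2 + 4 * R ^ 2 * ∑ i, pd i φ x ^ 2) := by
        refine setIntegral_mono_on (integrableOn_ball_of_continuous hcF R) (hi1.add hi2)
          Metric.isOpen_ball.measurableSet fun x hx => ?_
        refine (weighted_sum_sq_pd_le (hφ1.differentiable (by norm_num)) x).trans ?_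
        have hx' := (mem_ball_zero_iff.1 hx).le
        have hn := norm_nonneg x
        have : 2 * jb x ^ 2 ≤ 4 * R ^ 2 := by
          rw [jb_sq]
          nlinarith
        gcongr
    _ = 18 * (∫ x in Metric.ball 0 R, φ x ^ 2)
          + 4 * R ^ 2 * ∫ x in Metric.ball 0 R, ∑ i, pd i φ x ^ 2 := by
        rw [integral_add hi1 hi2, integral_const_mul, integral_const_mul]
    _ ≤ 18 * (4096 * 102784 * (∫ x, ∑ i, pd i φ x ^ 2) * R ^ 2)
          + 4 * R ^ 2 * ∫ x, ∑ i, pd i φ x ^ 2 := by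
        gcongr
        · exact integral_ball_sq_le hφ hker hE hR
        · exact Filter.Eventually.of_forall fun x => Finset.sum_nonneg fun i _ => sq_nonneg _
        · exact Measure.restrict_le_self
    _ = (18 * (4096 * 102784) + 4) * (∫ x, ∑ i, pd i φ x ^ 2) * R ^ 2 := by ring

/-- The weighted square norm of the trace-free Hessian. -/
def tfEnergy (F : R3 → ℝ) (x : R3) : ℝ := (jb x ^ 4)⁻¹ * ∑ i, ∑ j, tfHess F i j x ^ 2

lemma tfEnergy_nonneg (F : R3 → ℝ) (x : R3) : 0 ≤ tfEnergy F x := by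
  have := jb_pos x
  unfold tfEnergy
  positivity

lemma integrable_trunc_mul {f : R3 → ℝ} (hf : Continuous f) {R : ℝ} (hR : 0 < R) :
    Integrable fun x => trunc R x ^ 2 * f x :=
  ((contDiff_trunc_sq R).continuous.mul hf).integrable_of_hasCompactSupport
    (hasCompactSupport_trunc_sq hR).mul_right

lemma continuous_tfHess {F : R3 → ℝ} (hF : ContDiff ℝ 2 F) (i j : Fin 3) :
    Continuous (tfHess F i j) := by
  have h : ∀ i j, Continuous (pd i (pd j F)) := fun i j => continuous_pd (contDiff_pd hF j) i
  have hl : Continuous (lap F) := continuous_finsetSum _ fun k _ => h k k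
  unfold tfHess
  split_ifs
  · exact (h i j).sub (hl.div_const 3)
  · exact (h i j).sub continuous_const

lemma continuous_tfEnergy {F : R3 → ℝ} (hF : ContDiff ℝ 2 F) : Continuous (tfEnergy F) :=
  (contDiff_jb_pow_inv (m := 1) 4).continuous.mul <| continuous_finsetSum _ fun i _ =>
    continuous_finsetSum _ fun j _ => (continuous_tfHess hF i j).pow 2

lemma integral_trunc_mul_tfEnergy_le {F : R3 → ℝ} (hF : ContDiff ℝ 2 F)
    (hPDE : ∀ x, lap F x = 6 * ((∑ i, x i * pd i F x) - F x) * (jb x ^ 2)⁻¹)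
    {K : ℝ}
    (hK : ∀ R, 32 ≤ R → ∫ x in Metric.ball 0 R, (jb x ^ 4)⁻¹ * ∑ i, pd i F x ^ 2 ≤ K * R ^ 2)
    {δ R : ℝ} (hδ : 0 < δ) (hR : 32 ≤ R) :
    ∫ x, trunc R x ^ 2 * tfEnergy F x ≤
      (∫ x, trunc R x ^ 2 * ((‖x‖ ^ 2) ^ 2 / R ^ 4 * tfEnergy F x)) / (2 * δ) + 32 * δ * K := by
  have hR0 : 0 < R := by linarith
  have hF1 : ContDiff ℝ 1 F := hF.of_le (by norm_num)
  have hcj : Continuous fun x => (jb x ^ 4)⁻¹ := (contDiff_jb_pow_inv (m := 1) 4).continuous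
  have hcb : Continuous fun x => (jb x ^ 4)⁻¹ * ∑ i, pd i F x ^ 2 :=
    hcj.mul (continuous_finsetSum _ fun i _ => (continuous_pd hF1 i).pow 2)
  have hη := contDiff_trunc_sq R
  set h : R3 → ℝ := fun x => (jb x ^ 4)⁻¹ *
    ∑ i, ∑ j, tfHess F i j x * pd i (fun x => trunc R x ^ 2) x * pd j F x with hh
  have hhc : Continuous h := hcj.mul <| continuous_finsetSum _ fun i _ =>
    continuous_finsetSum _ fun j _ =>
      ((continuous_tfHess hF i j).mul (continuous_pd hη i)).mul (continuous_pd hF1 j)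
  have hh0 : ∀ x ∉ Metric.ball (0 : R3) R, h x = 0 := fun x hx => by
    simp [hh, pd_trunc_sq, trunc_eq_zero hR0 hx]
  have hhi : Integrable h := hhc.integrable_of_hasCompactSupport
    (HasCompactSupport.intro (isCompact_closedBall (0 : R3) R) fun x hx =>
      hh0 x fun h => hx (Metric.ball_subset_closedBall h))
  have hi1 : Integrable fun x => trunc R x ^ 2 * ((‖x‖ ^ 2) ^ 2 / R ^ 4 * tfEnergy F x) :=
    integrable_trunc_mul (((by fun_prop : Continuous fun x : R3 => (‖x‖ ^ 2) ^ 2 / R ^ 4)).mul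
      (continuous_tfEnergy hF)) hR0
  have hi2 : Integrable ((Metric.ball (0 : R3) R).indicator
      fun x => 32 * δ / R ^ 2 * ((jb x ^ 4)⁻¹ * ∑ i, pd i F x ^ 2)) :=
    (integrable_indicator_iff Metric.isOpen_ball.measurableSet).2
      (integrableOn_ball_of_continuous (continuous_const.mul hcb) R)
  have hpt : ∀ x, -h x ≤ trunc R x ^ 2 * ((‖x‖ ^ 2) ^ 2 / R ^ 4 * tfEnergy F x) / (2 * δ)
      + (Metric.ball (0 : R3) R).indicator
        (fun x => 32 * δ / R ^ 2 * ((jb x ^ 4)⁻¹ * ∑ i, pd i F x ^ 2)) x := by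
    intro x
    have h0 := jb_pos x
    by_cases hx : x ∈ Metric.ball (0 : R3) R
    · have hxR := (mem_ball_zero_iff.1 hx).le
      have hxn : ∑ i, x i ^ 2 ≤ R ^ 2 := by
        rw [← EuclideanSpace.real_norm_sq_eq]
        gcongr
      rw [Set.indicator_of_mem hx]
      have hy : ∀ i j, -(tfHess F i j x * pd i (fun x => trunc R x ^ 2) x * pd j F x) ≤
          trunc R x ^ 2 * ((‖x‖ ^ 2) ^ 2 / R ^ 4) / (2 * δ) * tfHess F i j x ^ 2
            + 32 * δ / R ^ 4 * (x i ^ 2 * pd j F x ^ 2) := by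
        intro i j
        rw [pd_trunc_sq]
        have := mul_nonneg (by positivity : 0 ≤ 1 / (2 * δ))
          (sq_nonneg (trunc R x * (‖x‖ ^ 2 / R ^ 2) * tfHess F i j x
            - δ * (8 * x i / R ^ 2 * pd j F x)))
        have e : 1 / (2 * δ) * (trunc R x * (‖x‖ ^ 2 / R ^ 2) * tfHess F i j x
            - δ * (8 * x i / R ^ 2 * pd j F x)) ^ 2 =
            trunc R x ^ 2 * ((‖x‖ ^ 2) ^ 2 / R ^ 4) / (2 * δ) * tfHess F i j x ^ 2
            + 32 * δ / R ^ 4 * (x i ^ 2 * pd j F x ^ 2)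
            + (tfHess F i j x * (-(8 * ‖x‖ ^ 2 * trunc R x / R ^ 4) * x i) * pd j F x) := by
          field_simp
          ring
        linarith
      calc -h x = (jb x ^ 4)⁻¹ *
            ∑ i, ∑ j, -(tfHess F i j x * pd i (fun x => trunc R x ^ 2) x * pd j F x) := by
            simp only [hh, Finset.sum_neg_distrib, mul_neg]
        _ ≤ (jb x ^ 4)⁻¹ * ∑ i, ∑ j,
            (trunc R x ^ 2 * ((‖x‖ ^ 2) ^ 2 / R ^ 4) / (2 * δ) * tfHess F i j x ^ 2
              + 32 * δ / R ^ 4 * (x i ^ 2 * pd j F x ^ 2)) := by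
            gcongr with i _ j _
            exact hy i j
        _ = trunc R x ^ 2 * ((‖x‖ ^ 2) ^ 2 / R ^ 4 * tfEnergy F x) / (2 * δ)
              + 32 * δ / R ^ 4 * ((jb x ^ 4)⁻¹ * ((∑ i, x i ^ 2) * ∑ i, pd i F x ^ 2)) := by
            simp only [Finset.sum_add_distrib, ← Finset.mul_sum, tfEnergy, ← Finset.sum_mul]
            ring
        _ ≤ trunc R x ^ 2 * ((‖x‖ ^ 2) ^ 2 / R ^ 4 * tfEnergy F x) / (2 * δ)
              + 32 * δ / R ^ 4 * ((jb x ^ 4)⁻¹ * (R ^ 2 * ∑ i, pd i F x ^ 2)) := by gcongr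
        _ = _ := by
            field_simp
    · rw [hh0 x hx, Set.indicator_of_notMem hx, trunc_eq_zero hR0 hx]
      simp
  have hid := integral_tfHess_identity hF hPDE hη (hasCompactSupport_trunc_sq hR0)
  simp only [mul_assoc] at hid
  calc ∫ x, trunc R x ^ 2 * tfEnergy F x = ∫ x, -h x := by
        rw [integral_neg]
        simp only [tfEnergy, hh, mul_assoc]
        exact hid
    _ ≤ ∫ x, (trunc R x ^ 2 * ((‖x‖ ^ 2) ^ 2 / R ^ 4 * tfEnergy F x) / (2 * δ)
      + (Metric.ball (0 : R3) R).indicator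
        (fun x => 32 * δ / R ^ 2 * ((jb x ^ 4)⁻¹ * ∑ i, pd i F x ^ 2)) x) :=
        integral_mono hhi.neg ((hi1.div_const _).add hi2) hpt
    _ = (∫ x, trunc R x ^ 2 * ((‖x‖ ^ 2) ^ 2 / R ^ 4 * tfEnergy F x)) / (2 * δ)
      + 32 * δ / R ^ 2 * ∫ x in Metric.ball 0 R, (jb x ^ 4)⁻¹ * ∑ i, pd i F x ^ 2 := by
        rw [integral_add (hi1.div_const _) hi2, integral_div,
          integral_indicator Metric.isOpen_ball.measurableSet, integral_const_mul]
    _ ≤ (∫ x, trunc R x ^ 2 * ((‖x‖ ^ 2) ^ 2 / R ^ 4 * tfEnergy F x)) / (2 * δ)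
      + 32 * δ / R ^ 2 * (K * R ^ 2) := by
        gcongr
        exact hK R hR
    _ = _ := by field_simp

lemma tfHess_eq_zero {F : R3 → ℝ} (hF : ContDiff ℝ 2 F)
    (hPDE : ∀ x, lap F x = 6 * ((∑ i, x i * pd i F x) - F x) * (jb x ^ 2)⁻¹)
    {K : ℝ}
    (hK : ∀ R, 32 ≤ R → ∫ x in Metric.ball 0 R, (jb x ^ 4)⁻¹ * ∑ i, pd i F x ^ 2 ≤ K * R ^ 2)
    (i j : Fin 3) (x : R3) : tfHess F i j x = 0 := by
  have hgc := continuous_tfEnergy hF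
  have hg0 := tfEnergy_nonneg F
  have hqc : ∀ R : ℝ, Continuous fun x : R3 => (‖x‖ ^ 2) ^ 2 / R ^ 4 := fun R => by fun_prop
  have hp1 : ∀ (R : ℝ) (x : R3), trunc R x ^ 2 ≤ 1 := fun R x =>
    pow_le_one₀ (trunc_nonneg R x) (trunc_le_one R x)
  have hpq : ∀ {R : ℝ}, 0 < R → ∀ x : R3, trunc R x ^ 2 * ((‖x‖ ^ 2) ^ 2 / R ^ 4 * tfEnergy F x) ≤
      trunc R x ^ 2 * tfEnergy F x := by
    intro R hR0 x
    by_cases hx : x ∈ Metric.ball (0 : R3) R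
    · have hxR := (mem_ball_zero_iff.1 hx).le
      have : (‖x‖ ^ 2) ^ 2 / R ^ 4 ≤ 1 := by
        rw [div_le_one (by positivity), ← pow_mul]
        gcongr
      exact mul_le_mul_of_nonneg_left (mul_le_of_le_one_left (hg0 x) this) (sq_nonneg _)
    · simp [trunc_eq_zero hR0 hx]
  have hbd : ∀ {R : ℝ}, 32 ≤ R → ∫ x, trunc R x ^ 2 * tfEnergy F x ≤ 64 * K := by
    intro R hR
    have hR0 : 0 < R := by linarith
    have h1 := integral_trunc_mul_tfEnergy_le hF hPDE hK one_pos hR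
    have h2 : ∫ x, trunc R x ^ 2 * ((‖x‖ ^ 2) ^ 2 / R ^ 4 * tfEnergy F x) ≤
        ∫ x, trunc R x ^ 2 * tfEnergy F x := integral_mono (integrable_trunc_mul ((hqc R).mul hgc) hR0)
      (integrable_trunc_mul hgc hR0) (hpq hR0)
    linarith
  have hint : Integrable (tfEnergy F) := by
    refine (aecover_ball (x := (0 : R3)) (μ := volume)
      tendsto_natCast_atTop_atTop).integrable_of_integral_norm_bounded (128 * K)
      (fun n => integrableOn_ball_of_continuous hgc n) ?_
    filter_upwards [Filter.eventually_ge_atTop 32] with n hn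
    have hn' : (32 : ℝ) ≤ n := by exact_mod_cast hn
    have hR : (32 : ℝ) ≤ 2 * n := by linarith
    have hR0 : (0 : ℝ) < 2 * n := by linarith
    have hI := integrable_trunc_mul hgc hR0
    calc ∫ x in Metric.ball 0 n, ‖tfEnergy F x‖
        ≤ ∫ x in Metric.ball 0 n, 2 * (trunc (2 * n) x ^ 2 * tfEnergy F x) := by
          refine setIntegral_mono_on (integrableOn_ball_of_continuous hgc.norm n)
            (hI.const_mul 2).integrableOn Metric.isOpen_ball.measurableSet fun x hx => ?_
          have hxR := (mem_ball_zero_iff.1 hx).le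
          have h1 : (‖x‖ ^ 2) ^ 2 / (2 * n) ^ 4 ≤ 1 / 16 := by
            rw [div_le_iff₀ (by positivity), ← pow_mul]
            calc ‖x‖ ^ (2 * 2) ≤ (n : ℝ) ^ (2 * 2) := by gcongr
              _ = 1 / 16 * (2 * (n : ℝ)) ^ 4 := by ring
          have h2 := le_trunc (2 * n) x
          have h3 : 1 ≤ 2 * trunc (2 * n) x ^ 2 := by nlinarith
          rw [Real.norm_of_nonneg (hg0 x)]
          nlinarith [hg0 x]
      _ ≤ ∫ x, 2 * (trunc (2 * n) x ^ 2 * tfEnergy F x) :=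
          setIntegral_le_integral (hI.const_mul 2) (Filter.Eventually.of_forall fun x =>
            mul_nonneg zero_le_two (mul_nonneg (sq_nonneg _) (hg0 x)))
      _ ≤ 128 * K := by
          rw [integral_const_mul]
          linarith [hbd hR]
  have hq : ∀ x : R3, Filter.Tendsto (fun n : ℕ => (‖x‖ ^ 2) ^ 2 / (n : ℝ) ^ 4) Filter.atTop
      (nhds 0) := fun x => Filter.Tendsto.div_atTop tendsto_const_nhds
    ((Filter.tendsto_pow_atTop (by norm_num)).comp tendsto_natCast_atTop_atTop)
  have hp : ∀ x : R3, Filter.Tendsto (fun n : ℕ => trunc n x ^ 2) Filter.atTop (nhds 1) := by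
    intro x
    have := ((tendsto_const_nhds (x := (0 : ℝ))).max
      ((tendsto_const_nhds (x := (1 : ℝ))).sub (hq x))).pow 2
    simpa [trunc] using this
  have hlim1 : Filter.Tendsto (fun n : ℕ => ∫ x, trunc n x ^ 2 * tfEnergy F x) Filter.atTop
      (nhds (∫ x, tfEnergy F x)) := by
    refine tendsto_integral_of_dominated_convergence (tfEnergy F)
      (fun n => ((contDiff_trunc_sq n).continuous.mul hgc).aestronglyMeasurable) hint
      (fun n => Filter.Eventually.of_forall fun x => ?_) (Filter.Eventually.of_forall fun x => ?_)
    · rw [Real.norm_of_nonneg (mul_nonneg (sq_nonneg _) (hg0 x))]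
      exact mul_le_of_le_one_left (hg0 x) (hp1 n x)
    · simpa using (hp x).mul_const (tfEnergy F x)
  have hlim2 : Filter.Tendsto
      (fun n : ℕ => ∫ x, trunc n x ^ 2 * ((‖x‖ ^ 2) ^ 2 / (n : ℝ) ^ 4 * tfEnergy F x))
      Filter.atTop (nhds 0) := by
    rw [← integral_zero R3 ℝ]
    refine tendsto_integral_filter_of_dominated_convergence (tfEnergy F)
      (Filter.Eventually.of_forall fun n =>
        ((contDiff_trunc_sq n).continuous.mul ((hqc n).mul hgc)).aestronglyMeasurable)
      ?_ hint (Filter.Eventually.of_forall fun x => ?_)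
    · filter_upwards [Filter.eventually_gt_atTop 0] with n hn
      refine Filter.Eventually.of_forall fun x => ?_
      have hn' : (0 : ℝ) < n := by exact_mod_cast hn
      have := hg0 x
      rw [Real.norm_of_nonneg (by positivity)]
      exact (hpq hn' x).trans (mul_le_of_le_one_left (hg0 x) (hp1 n x))
    · simpa using (hp x).mul ((hq x).mul_const (tfEnergy F x))
  have hle : ∀ δ : ℝ, 0 < δ → ∫ x, tfEnergy F x ≤ 32 * δ * K := by
    intro δ hδ
    have hlim3 := (hlim2.div_const (2 * δ)).add_const (32 * δ * K)
    rw [zero_div, zero_add] at hlim3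
    refine le_of_tendsto_of_tendsto hlim1 hlim3 ?_
    filter_upwards [Filter.eventually_ge_atTop 32] with n hn
    exact integral_trunc_mul_tfEnergy_le hF hPDE hK hδ (by exact_mod_cast hn)
  have hlim4 : Filter.Tendsto (fun δ : ℝ => 32 * δ * K) (nhdsWithin 0 (Set.Ioi 0)) (nhds 0) := by
    have : Filter.Tendsto (fun δ : ℝ => 32 * δ * K) (nhds 0) (nhds (32 * 0 * K)) :=
      (by fun_prop : Continuous fun δ : ℝ => 32 * δ * K).tendsto 0
    simpa using this.mono_left nhdsWithin_le_nhds
  have hzero : ∫ x, tfEnergy F x = 0 := by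
    refine le_antisymm (ge_of_tendsto hlim4 ?_) (integral_nonneg hg0)
    filter_upwards [self_mem_nhdsWithin] with δ hδ using hle δ hδ
  have hae := (integral_eq_zero_iff_of_nonneg hg0 hint).1 hzero
  have hx := congrFun ((hgc.ae_eq_iff_eq volume continuous_const).1 hae) x
  have h0 := jb_pos x
  have hx' : ∑ i, ∑ j, tfHess F i j x ^ 2 = 0 := by
    rcases mul_eq_zero.1 hx with h | h
    · exact absurd h (by positivity)
    · exact h
  rw [Finset.sum_eq_zero_iff_of_nonneg fun i _ => Finset.sum_nonneg fun j _ => sq_nonneg _] at hx'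
  have hi := hx' i (Finset.mem_univ i)
  rw [Finset.sum_eq_zero_iff_of_nonneg fun j _ => sq_nonneg _] at hi
  exact pow_eq_zero_iff (two_ne_zero) |>.1 (hi j (Finset.mem_univ j))

lemma eq_apply_zero_of_pd_eq_zero {f : R3 → ℝ} (hf : Differentiable ℝ f)
    (h : ∀ i x, pd i f x = 0) (x : R3) : f x = f 0 :=
  is_const_of_fderiv_eq_zero hf (fun y => by ext v; simp [fderiv_eq_sum_pd, h]) x 0

lemma eq_quadratic_of_tfHess_eq_zero {F : R3 → ℝ} (hF : ContDiff ℝ 2 F)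
    (hPDE : ∀ x, lap F x = 6 * ((∑ i, x i * pd i F x) - F x) * (jb x ^ 2)⁻¹)
    (h : ∀ i j x, tfHess F i j x = 0) (x : R3) :
    F x = F 0 * (1 - ‖x‖ ^ 2) + ∑ i, pd i F 0 * x i := by
  have hd := hF.differentiable (by norm_num)
  have hdi : ∀ i, Differentiable ℝ (pd i F) := fun i =>
    (contDiff_pd hF i).differentiable (by norm_num)
  have hj0 : jb 0 ^ 2 = 1 := by simp [jb_sq]
  have hl : ∀ x, lap F x = -6 * F 0 := by
    intro x
    rw [eq_apply_zero_of_pd_eq_zero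
      ((contDiff_lap_of_conformal hF hPDE).differentiable (by norm_num)) (fun j x => by
        rw [pd_lap_of_conformal hF hPDE]
        simp [h]) x, hPDE, hj0]
    simp
  have hcd : ∀ (i : Fin 3) (a : ℝ), Differentiable ℝ fun x : R3 => a * x i := fun i a =>
    (differentiable_coord i).const_mul a
  have h2 : ∀ i x, pd i F x = pd i F 0 - 2 * F 0 * x i := by
    intro i x
    have := eq_apply_zero_of_pd_eq_zero (f := fun x => pd i F x + 2 * F 0 * x i)
      ((hdi i).add (hcd i _)) (fun j x => by
        rw [pd_add j (hdi i x) (hcd i _ x), pd_const_mul j _ (differentiable_coord i x), pd_coord]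
        have h1 := h j i x
        rw [tfHess, hl] at h1
        by_cases hij : i = j
        · rw [if_pos hij.symm] at h1
          rw [if_pos hij]
          linarith
        · rw [if_neg (Ne.symm hij)] at h1
          rw [if_neg hij]
          linarith) x
    simp only [PiLp.zero_apply, mul_zero, add_zero] at this
    linarith
  have hnd : Differentiable ℝ fun x : R3 => ‖x‖ ^ 2 :=
    (contDiff_norm_sq ℝ (n := 1)).differentiable (by norm_num)
  have hsd : Differentiable ℝ fun x : R3 => fderiv ℝ F 0 x := (fderiv ℝ F 0).differentiable
  have hsp : ∀ i x, pd i (fun x => fderiv ℝ F 0 x) x = pd i F 0 := by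
    intro i x
    rw [pd, ContinuousLinearMap.fderiv, pd]
  have := eq_apply_zero_of_pd_eq_zero
    (f := fun x => F x + F 0 * ‖x‖ ^ 2 - fderiv ℝ F 0 x) ((hd.add (hnd.const_mul _)).sub hsd)
    (fun i x => by
      rw [pd_sub (f := fun x => F x + F 0 * ‖x‖ ^ 2) i ((hd x).add ((hnd x).const_mul _)) (hsd x),
        pd_add i (hd x) ((hnd x).const_mul _), pd_const_mul i _ (hnd x), pd_norm_sq, hsp, h2]
      ring) x
  simp only [map_zero, norm_zero] at this
  rw [fderiv_eq_sum_pd] at this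
  simp only [mul_comm (pd _ F 0)]
  linarith

/-- Finite-energy solutions of the linearized equation at the standard bubble. -/
theorem eq_of_lap_eq {φ : R3 → ℝ} (hφ : ContDiff ℝ 2 φ)
    (hker : ∀ x, lap φ x = -(15 * φ x / jb x ^ 4))
    (hE : Integrable fun x => ∑ i, pd i φ x ^ 2) :
    ∃ (a : ℝ) (b : Fin 3 → ℝ), ∀ x,
      φ x = (a * (1 - ‖x‖ ^ 2) + ∑ i, b i * x i) / jb x ^ 3 := by
  have hF : ContDiff ℝ 2 (fun y => jb y ^ 3 * φ y) := (contDiff_jb.pow 3).mul hφ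
  have hPDE := lap_jb_cube_mul hφ hker
  have htf := tfHess_eq_zero hF hPDE fun R hR =>
    integral_ball_weighted_sum_sq_pd_le hφ hker hE hR
  refine ⟨jb 0 ^ 3 * φ 0, fun i => pd i (fun y => jb y ^ 3 * φ y) 0, fun x => ?_⟩
  rw [eq_div_iff (pow_pos (jb_pos x) 3).ne', mul_comm]
  exact eq_quadratic_of_tfHess_eq_zero hF hPDE htf x

/-! ### Classification of positive radial solutions -/

lemma eq_of_hasDerivAt_zero_Ioi {f : ℝ → ℝ} (h : ∀ s, 0 < s → HasDerivAt f 0 s) {s t : ℝ}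
    (hs : 0 < s) (ht : 0 < t) : f s = f t :=
  isOpen_Ioi.is_const_of_deriv_eq_zero isPreconnected_Ioi
    (fun x hx => (h x hx).differentiableAt.differentiableWithinAt) (fun x hx => (h x hx).deriv)
    (Set.mem_Ioi.2 hs) (Set.mem_Ioi.2 ht)

/-- Positive solutions of the radial equation, in the variable `s = |x|²`, are Aubin–Talenti
bubbles. -/
lemma inv_sq_eq_of_radial_ode {c : ℝ} (hc : 0 < c) {G G₁ G₂ : ℝ → ℝ} (hpos : ∀ s, 0 < G s)
    (h₁ : ∀ s, 0 < s → HasDerivAt G (G₁ s) s) (h₂ : ∀ s, 0 < s → HasDerivAt G₁ (G₂ s) s)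
    (hode : ∀ s, 0 < s → c * (4 * s * G₂ s + 6 * G₁ s) = -G s ^ 5)
    (hG : Filter.Tendsto G (nhdsWithin 0 (Set.Ioi 0)) (nhds (G 0))) {l : ℝ}
    (hl : Filter.Tendsto (fun s => s * G₁ s ^ 2) (nhdsWithin 0 (Set.Ioi 0)) (nhds l))
    {s : ℝ} (hs : 0 < s) : (G s ^ 2)⁻¹ = (G 0 ^ 2)⁻¹ + G 0 ^ 2 / (3 * c) * s := by
  have hode' : ∀ s, 0 < s → G₂ s = (-G s ^ 5 / c - 6 * G₁ s) / (4 * s) := by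
    intro s hs
    have := hode s hs
    field_simp
    linarith
  set M : ℝ → ℝ := fun s => 12 * (s * G₁ s ^ 2) + 6 * (G s * G₁ s) + G s ^ 6 / c with hM
  have hM' : ∀ s, 0 < s → HasDerivAt M (-3 / (2 * s) * M s) s := by
    intro s hs
    have h := ((((hasDerivAt_id s).mul ((h₂ s hs).pow 2)).const_mul 12).add
      (((h₁ s hs).mul (h₂ s hs)).const_mul 6)).add (((h₁ s hs).pow 6).div_const c)
    refine h.congr_deriv ?_
    simp only [hM, hode' s hs, id, Pi.pow_apply]
    field_simp
    push_cast
    ring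
  have hN' : ∀ s, 0 < s → HasDerivAt (fun s => s ^ 3 * M s ^ 2) 0 s := by
    intro s hs
    refine ((hasDerivAt_pow 3 s).mul ((hM' s hs).pow 2)).congr_deriv ?_
    simp only [Pi.pow_apply]
    field_simp
    push_cast
    ring
  have hid : Filter.Tendsto (fun s : ℝ => s) (nhdsWithin 0 (Set.Ioi 0)) (nhds 0) :=
    Filter.tendsto_id.mono_left nhdsWithin_le_nhds
  have hsG₁ : Filter.Tendsto (fun s => s * G₁ s) (nhdsWithin 0 (Set.Ioi 0)) (nhds 0) := by
    have h : Filter.Tendsto (fun s => (s * G₁ s) ^ 2) (nhdsWithin 0 (Set.Ioi 0)) (nhds 0) := by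
      have := hid.mul hl
      rw [zero_mul] at this
      exact this.congr fun s => by ring
    have h' := h.sqrt
    simp only [Real.sqrt_sq_eq_abs, Real.sqrt_zero] at h'
    exact (tendsto_zero_iff_abs_tendsto_zero _).2 h'
  have hsM : Filter.Tendsto (fun s => s * M s) (nhdsWithin 0 (Set.Ioi 0)) (nhds 0) := by
    have := (((hid.mul hl).const_mul 12).add ((hG.mul hsG₁).const_mul 6)).add
      (hid.mul ((hG.pow 6).div_const c))
    simp only [zero_mul, mul_zero, add_zero] at this
    refine this.congr fun s => ?_
    simp only [hM]
    ring
  have hN0 : Filter.Tendsto (fun s => s ^ 3 * M s ^ 2) (nhdsWithin 0 (Set.Ioi 0)) (nhds 0) := by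
    have := hid.mul (hsM.pow 2)
    rw [zero_mul] at this
    exact this.congr fun s => by ring
  have hM0 : ∀ s, 0 < s → M s = 0 := by
    intro s hs
    have h : Filter.Tendsto (fun s => s ^ 3 * M s ^ 2) (nhdsWithin 0 (Set.Ioi 0))
        (nhds (s ^ 3 * M s ^ 2)) := by
      refine tendsto_const_nhds.congr' ?_
      filter_upwards [self_mem_nhdsWithin] with t ht
      exact eq_of_hasDerivAt_zero_Ioi hN' hs ht
    have := tendsto_nhds_unique h hN0
    have hs3 : s ^ 3 ≠ 0 := by positivity
    simpa [hs3] using this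
  set V₁ : ℝ → ℝ := fun s => -2 * (G₁ s * (G s ^ 3)⁻¹) with hV₁
  have hV : ∀ s, 0 < s → HasDerivAt (fun s => (G s ^ 2)⁻¹) (V₁ s) s := by
    intro s hs
    have h0 := hpos s
    refine (((h₁ s hs).pow 2).inv (pow_ne_zero 2 h0.ne')).congr_deriv ?_
    simp only [hV₁, Pi.pow_apply]
    field_simp
    push_cast
    ring
  have hV' : ∀ s, 0 < s → HasDerivAt V₁ 0 s := by
    intro s hs
    have h0 := hpos s
    refine (((h₂ s hs).mul (((h₁ s hs).pow 3).inv (pow_ne_zero 3 h0.ne'))).const_mul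
      (-2)).congr_deriv ?_
    have e : -2 * (G₂ s * (G s ^ 3)⁻¹ + G₁ s * (-(3 * G s ^ 2 * G₁ s) / (G s ^ 3) ^ 2)) =
        M s / (2 * s * G s ^ 4) := by
      simp only [hM, hode' s hs]
      field_simp
      ring
    rw [hM0 s hs, zero_div] at e
    rw [← e]
    simp [Pi.pow_apply, Pi.inv_apply]
  set B := V₁ s with hB
  have hVB : ∀ t, 0 < t → V₁ t = B := fun t ht => eq_of_hasDerivAt_zero_Ioi hV' ht hs
  have hA : (G s ^ 2)⁻¹ - B * s = (G 0 ^ 2)⁻¹ := by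
    have hd : ∀ t, 0 < t → HasDerivAt (fun t => (G t ^ 2)⁻¹ - B * t) 0 t := by
      intro t ht
      refine ((hV t ht).sub ((hasDerivAt_id t).const_mul B)).congr_deriv ?_
      rw [hVB t ht]
      ring
    have h : Filter.Tendsto (fun t => (G t ^ 2)⁻¹ - B * t) (nhdsWithin 0 (Set.Ioi 0))
        (nhds ((G s ^ 2)⁻¹ - B * s)) := by
      refine tendsto_const_nhds.congr' ?_
      filter_upwards [self_mem_nhdsWithin] with t ht
      exact eq_of_hasDerivAt_zero_Ioi hd hs ht
    have h' := ((hG.pow 2).inv₀ (pow_ne_zero 2 (hpos 0).ne')).sub (hid.const_mul B)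
    rw [mul_zero, sub_zero] at h'
    exact tendsto_nhds_unique h h'
  have hs0 := hpos s
  have h00 := hpos 0
  have hG₁ : G₁ s = -(B / 2) * G s ^ 3 := by
    rw [hB]
    simp only [hV₁]
    field_simp
  have hBval : B * (G 0 ^ 2)⁻¹ = 1 / (3 * c) := by
    have h := hM0 s hs
    simp only [hM, hG₁] at h
    have h' : G s ^ 6 * (3 * s * B ^ 2 - 3 * B * (G s ^ 2)⁻¹ + 1 / c) = 0 := by
      rw [← h]
      field_simp
      ring
    rcases mul_eq_zero.1 h' with h'' | h''
    · exact absurd h'' (by positivity)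
    · rw [← hA]
      field_simp at h'' ⊢
      linarith
  have hB2 : B = G 0 ^ 2 / (3 * c) := by
    field_simp at hBval ⊢
    linarith
  rw [← hB2, ← hA]
  ring

theorem inv_sq_eq_of_radial {c : ℝ} (hc : 0 < c) {u : R3 → ℝ} (hpos : ∀ x, 0 < u x)
    (hrad : ∀ x y : R3, ‖x‖ = ‖y‖ → u x = u y) (hreg : ContDiff ℝ 2 u)
    (heq : ∀ x, -(c * lap u x) = u x ^ 5) (x : R3) :
    (u x ^ 2)⁻¹ = (u 0 ^ 2)⁻¹ + u 0 ^ 2 / (3 * c) * ‖x‖ ^ 2 := by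
  set e : R3 := EuclideanSpace.single 0 1
  have he : ‖e‖ = 1 := by simp [e]
  set f : ℝ → ℝ := fun r => u (r • e) with hf
  have hfc : ContDiff ℝ 2 f := hreg.comp (contDiff_id.smul contDiff_const)
  have hf₁c : ContDiff ℝ 1 (deriv f) := hfc.deriv'
  set G : ℝ → ℝ := fun s => f √s with hG
  have hu : ∀ y, u y = G (‖y‖ ^ 2) := fun y => hrad _ _ (by
    rw [Real.sqrt_sq (norm_nonneg y), norm_smul, he, norm_norm, mul_one])
  set G₁ : ℝ → ℝ := fun s => deriv f √s * (1 / (2 * √s)) with hG₁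
  have h₁ : ∀ s, 0 < s → HasDerivAt G (G₁ s) s := fun s hs =>
    (hfc.differentiable (by norm_num) _).hasDerivAt.comp s (Real.hasDerivAt_sqrt hs.ne')
  have h₂ : ∀ s, 0 < s → HasDerivAt G₁ (deriv G₁ s) s := by
    intro s hs
    have hsq := (Real.hasDerivAt_sqrt hs.ne').differentiableAt
    refine DifferentiableAt.hasDerivAt (DifferentiableAt.mul
      ((hf₁c.differentiable (by norm_num) _).comp s hsq) (DifferentiableAt.div
        (differentiableAt_const _) (hsq.const_mul 2) ?_))
    have := Real.sqrt_pos.2 hs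
    positivity
  have hn : Differentiable ℝ fun y : R3 => ‖y‖ ^ 2 :=
    (contDiff_norm_sq ℝ (n := 1)).differentiable (by norm_num)
  have hnpos : ∀ {y : R3}, y ≠ 0 → 0 < ‖y‖ ^ 2 := fun hy => pow_pos (norm_pos_iff.2 hy) 2
  have hpd : ∀ i {y : R3}, y ≠ 0 → pd i u y = G₁ (‖y‖ ^ 2) * (2 * y i) := by
    intro i y hy
    rw [show u = fun y => G (‖y‖ ^ 2) from funext hu,
      pd_comp (f := fun y : R3 => ‖y‖ ^ 2) i (h₁ _ (hnpos hy)) (hn y), pd_norm_sq]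
  have hpd2 : ∀ i {y : R3}, y ≠ 0 →
      pd i (pd i u) y = 4 * y i ^ 2 * deriv G₁ (‖y‖ ^ 2) + 2 * G₁ (‖y‖ ^ 2) := by
    intro i y hy
    have hev : pd i u =ᶠ[nhds y] fun y => G₁ (‖y‖ ^ 2) * (2 * y i) := by
      filter_upwards [isOpen_ne.mem_nhds hy] with z hz using hpd i hz
    have hd2 : DifferentiableAt ℝ (fun y : R3 => 2 * y i) y :=
      (differentiable_coord i y).const_mul 2
    have hd1 : DifferentiableAt ℝ (fun y : R3 => G₁ (‖y‖ ^ 2)) y :=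
      (h₂ _ (hnpos hy)).differentiableAt.comp (f := fun y : R3 => ‖y‖ ^ 2) y (hn y)
    rw [pd, hev.fderiv_eq]
    change pd i _ y = _
    rw [pd_mul i hd1 hd2, pd_comp (f := fun y : R3 => ‖y‖ ^ 2) i (h₂ _ (hnpos hy)) (hn y),
      pd_norm_sq, pd_const_mul i _ (differentiable_coord i y), pd_coord, if_pos rfl]
    ring
  have hode : ∀ s, 0 < s → c * (4 * s * deriv G₁ s + 6 * G₁ s) = -G s ^ 5 := by
    intro s hs
    have hy : √s • e ≠ 0 := by
      rw [← norm_pos_iff, norm_smul, he, mul_one]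
      exact norm_pos_iff.2 (Real.sqrt_pos.2 hs).ne'
    have hys : ‖√s • e‖ ^ 2 = s := by
      rw [norm_smul, he, mul_one, Real.norm_eq_abs, sq_abs, Real.sq_sqrt hs.le]
    have h := heq (√s • e)
    have hsum := EuclideanSpace.real_norm_sq_eq (√s • e)
    rw [lap_eq_sum_pd, Finset.sum_congr rfl fun i _ => hpd2 i hy, Finset.sum_add_distrib,
      ← Finset.sum_mul, ← Finset.mul_sum, ← hsum, hys] at h
    simp only [Finset.sum_const, Finset.card_univ, Fintype.card_fin, nsmul_eq_mul] at h
    have h' : G s = u (√s • e) := rfl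
    rw [h', ← h]
    push_cast
    ring
  have hsq0 : Filter.Tendsto (fun s => √s) (nhdsWithin 0 (Set.Ioi 0)) (nhds 0) := by
    have := (Real.continuous_sqrt.tendsto 0).mono_left
      (nhdsWithin_le_nhds (s := Set.Ioi (0 : ℝ)))
    rwa [Real.sqrt_zero] at this
  have hG0 : Filter.Tendsto G (nhdsWithin 0 (Set.Ioi 0)) (nhds (G 0)) := by
    simpa [hG, Function.comp_def] using (hfc.continuous.tendsto 0).comp hsq0
  have hl : Filter.Tendsto (fun s => s * G₁ s ^ 2) (nhdsWithin 0 (Set.Ioi 0))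
      (nhds (deriv f 0 ^ 2 / 4)) := by
    refine ((((hf₁c.continuous.tendsto 0).comp hsq0).pow 2).div_const 4).congr' ?_
    filter_upwards [self_mem_nhdsWithin] with s hs
    have h1 : √s ^ 2 = s := Real.sq_sqrt (le_of_lt hs)
    have h2 : 0 < √s := Real.sqrt_pos.2 hs
    simp only [hG₁, Function.comp]
    nth_rewrite 2 [← h1]
    field_simp
    norm_num
  have hG00 : G 0 = u 0 := by simp [hG, hf]
  by_cases hx : x = 0
  · simp [hx]
  · rw [hu x, ← hG00]
    exact inv_sq_eq_of_radial_ode hc (fun s => hpos _) h₁ h₂ hode hG0 hl (hnpos hx)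

/-! ### Rescaling to the standard bubble -/

lemma pd_comp_smul (i : Fin 3) (k : ℝ) (f : R3 → ℝ) (x : R3) :
    pd i (fun y => f (k • y)) x = k * pd i f (k • x) := by
  rw [pd, fderiv_comp_smul]
  rfl

lemma lap_comp_smul {f : R3 → ℝ} (hf : ContDiff ℝ 2 f) (k : ℝ) (x : R3) :
    lap (fun y => f (k • y)) x = k ^ 2 * lap f (k • x) := by
  have h : ∀ i, pd i (fun y => f (k • y)) = fun y => k * pd i f (k • y) := fun i =>
    funext fun y => pd_comp_smul i k f y
  have hd : ∀ i, Differentiable ℝ fun y => pd i f (k • y) := fun i =>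
    ((contDiff_pd hf i).differentiable (by norm_num)).comp (differentiable_id.const_smul k)
  rw [lap_eq_sum_pd, lap_eq_sum_pd, Finset.mul_sum]
  refine Finset.sum_congr rfl fun i _ => ?_
  rw [h, pd_const_mul i k (hd i x), pd_comp_smul]
  ring

/-- nondegeneracy of the Aubin–Talenti bubble: if `u` is a positive radial
finite-energy `C²` solution of `-cΔu = u⁵` on `ℝ³` and `φ` is a finite-energy `C²` solution of
the linearized equation `𝒜φ = -cΔφ - 5u⁴φ = 0`, then `φ` is a linear combination of
`u/2 + x·∇u` and the partial derivatives `∂u/∂xᵢ`, `i = 1, 2, 3`. -/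
theorem critical_equation_nondegeneracy (c : ℝ) (hc : 0 < c)
    (u : R3 → ℝ) (hpos : ∀ x, 0 < u x) (hrad : ∀ x y : R3, ‖x‖ = ‖y‖ → u x = u y)
    (hreg : ContDiff ℝ 2 u)
    (hfin : Integrable (fun x : R3 => ‖gradient u x‖ ^ 2))
    (heq : ∀ x, -(c * lap u x) = u x ^ 5)
    (φ : R3 → ℝ) (hφreg : ContDiff ℝ 2 φ)
    (hφfin : Integrable (fun x : R3 => ‖gradient φ x‖ ^ 2))
    (hker : ∀ x, -(c * lap φ x) - 5 * u x ^ 4 * φ x = 0) :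
    ∃ l₀ l₁ l₂ l₃ : ℝ, ∀ x,
      φ x = l₀ * (u x / 2 + ⟪x, gradient u x⟫)
        + l₁ * fderiv ℝ u x (EuclideanSpace.single 0 1)
        + l₂ * fderiv ℝ u x (EuclideanSpace.single 1 1)
        + l₃ * fderiv ℝ u x (EuclideanSpace.single 2 1) := by
  set α := u 0 with hα
  have hα0 : 0 < α := hpos 0
  set k := α ^ 2 / √(3 * c) with hk
  have hk0 : 0 < k := by positivity
  have hk2 : k ^ 2 * (3 * c) = α ^ 4 := by
    rw [hk, div_pow, Real.sq_sqrt (by positivity)]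
    field_simp
  have hjb : ∀ x, jb (k • x) ^ 2 = 1 + k ^ 2 * ‖x‖ ^ 2 := fun x => by
    rw [jb_sq, norm_smul, mul_pow, Real.norm_eq_abs, sq_abs]
  have hu : ∀ x, u x = α * (jb (k • x) ^ 1)⁻¹ := by
    intro x
    have h := inv_sq_eq_of_radial hc hpos hrad hreg heq x
    have h0 := jb_pos (k • x)
    have hux := hpos x
    rw [← hα] at h
    have h1 : (u x ^ 2)⁻¹ = jb (k • x) ^ 2 / α ^ 2 := by
      rw [h, hjb]
      field_simp
      linear_combination ‖x‖ ^ 2 * (-hk2)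
    have h2 : u x ^ 2 = (α * (jb (k • x) ^ 1)⁻¹) ^ 2 := by
      rw [← inv_inj, h1]
      field_simp
    exact (pow_left_inj₀ hux.le (by positivity) two_ne_zero).1 h2
  have hpdu : ∀ i x, pd i u x = -(α * k ^ 2) * x i / jb (k • x) ^ 3 := by
    intro i x
    have hd : Differentiable ℝ fun y : R3 => (jb (k • y) ^ 1)⁻¹ :=
      ((contDiff_jb_pow_inv (m := 1) 1).differentiable (by norm_num)).comp
        (differentiable_id.const_smul k)
    rw [show u = fun x => α * (jb (k • x) ^ 1)⁻¹ from funext hu, pd_const_mul i _ (hd x),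
      pd_comp_smul i k (fun y => (jb y ^ 1)⁻¹), pd_jb_pow_inv]
    simp only [PiLp.smul_apply, smul_eq_mul]
    push_cast
    ring
  have hψker : ∀ y, lap (fun y => φ (k⁻¹ • y)) y = -(15 * φ (k⁻¹ • y) / jb y ^ 4) := by
    intro y
    have h := hker (k⁻¹ • y)
    have h0 := jb_pos y
    rw [hu, smul_inv_smul₀ hk0.ne'] at h
    rw [lap_comp_smul hφreg]
    generalize lap φ (k⁻¹ • y) = L, φ (k⁻¹ • y) = p at h ⊢
    field_simp at h ⊢
    have h' : c * (L * jb y ^ 4 + 15 * k ^ 2 * p) = 0 := by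
      linear_combination -h + 5 * p * hk2
    have := (mul_eq_zero.1 h').resolve_left hc.ne'
    linarith
  have hψE : Integrable fun y => ∑ i, pd i (fun y => φ (k⁻¹ • y)) y ^ 2 := by
    simp only [pd_comp_smul, mul_pow, ← Finset.mul_sum]
    simp only [norm_gradient_sq] at hφfin
    exact (hφfin.comp_smul (inv_ne_zero hk0.ne')).const_mul _
  obtain ⟨a, b, hab⟩ := eq_of_lap_eq (hφreg.comp (contDiff_const_smul k⁻¹)) hψker hψE
  refine ⟨2 * a / α, -b 0 / (α * k), -b 1 / (α * k), -b 2 / (α * k), fun x => ?_⟩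
  have h := hab (k • x)
  have h0 := jb_pos (k • x)
  have hj := hjb x
  have hn : ‖x‖ ^ 2 = ∑ i, x i ^ 2 := EuclideanSpace.real_norm_sq_eq x
  rw [Function.comp_apply, inv_smul_smul₀ hk0.ne', norm_smul, mul_pow, Real.norm_eq_abs,
    sq_abs] at h
  rw [h, inner_gradient]
  change _ = _ + _ * pd 0 u x + _ * pd 1 u x + _ * pd 2 u x
  simp only [hpdu, hu x, Fin.sum_univ_three, PiLp.smul_apply, smul_eq_mul] at hn ⊢
  field_simp
  rw [hj, hn]
  ring
end
end

section
/- Let a, b > 0 and let u be the positive radial C² solution of the Kirchhoff equation -(a + b∫_{ℝ³}|∇u|² dx) Δu = u⁵ in ℝ³ with ∫_{ℝ³}|∇u|² dx < ∞ given by u(x) = Q(x/√c), where Q(x) = 3^{1/4}(1+|x|^2)^{-1/2}, k = ∫_{ℝ³}|∇Q|² dx, and √c = (1/2)(b·k + √(b²k² + 4a)). If φ : ℝ³ → ℝ is a radially symmetric C² function with ∫_{ℝ³}|∇φ|² dx < ∞ satisfying L₊φ = 0 pointwise on ℝ³, then there exists λ ∈ ℝ such that φ(x) = λ(u(x)/2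 + x·∇u(x)) for all x ∈ ℝ³. -/
open MeasureTheory
open scoped RealInnerProductSpace

noncomputable section

/-- The derivative of a radial function vanishes in tangential directions. -/
theorem fderiv_radial_tangent {E : Type*} [NormedAddCommGroup E] [InnerProductSpace ℝ E]
    {F : E → ℝ} (hrad : ∀ x y : E, ‖x‖ = ‖y‖ → F x = F y) {x v : E}
    (hF : DifferentiableAt ℝ F x) (hxv : ⟪x, v⟫ = 0) (hv : ‖v‖ = ‖x‖) :
    fderiv ℝ F x v = 0 := by
  have hγ : HasDerivAt (fun θ : ℝ => Real.cos θ • x + Real.sin θ • v) v 0 := by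
    have h := ((Real.hasDerivAt_cos 0).smul_const x).add ((Real.hasDerivAt_sin 0).smul_const v)
    exact h.congr_deriv (by simp)
  have hγ0 : Real.cos 0 • x + Real.sin 0 • v = x := by simp
  have hnorm : ∀ θ : ℝ, ‖Real.cos θ • x + Real.sin θ • v‖ = ‖x‖ := by
    intro θ
    rw [← sq_eq_sq₀ (norm_nonneg _) (norm_nonneg _), norm_add_sq_real, norm_smul, norm_smul,
      real_inner_smul_left, real_inner_smul_right, hxv, hv, mul_pow, mul_pow, Real.norm_eq_abs,
      Real.norm_eq_abs, sq_abs, sq_abs]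
    linear_combination ‖x‖ ^ 2 * Real.sin_sq_add_cos_sq θ
  have hF' : HasFDerivAt F (fderiv ℝ F x) (Real.cos 0 • x + Real.sin 0 • v) := by
    rw [hγ0]; exact hF.hasFDerivAt
  have h1 := hF'.comp_hasDerivAt (0 : ℝ) hγ
  have h2 : (F ∘ fun θ : ℝ => Real.cos θ • x + Real.sin θ • v) = fun _ => F x := by
    funext θ
    exact hrad _ _ (hnorm θ)
  rw [h2] at h1
  exact h1.unique (hasDerivAt_const _ _)

theorem hasDerivAt_comp_smul_const {E : Type*} [NormedAddCommGroup E] [NormedSpace ℝ E]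
    {G : E → ℝ} (hG : Differentiable ℝ G) (e : E) (t : ℝ) :
    HasDerivAt (fun t : ℝ => G (t • e)) (fderiv ℝ G (t • e) e) t := by
  have h := (hasDerivAt_id t).smul_const e
  simp only [one_smul, id] at h
  exact (hG (t • e)).hasFDerivAt.comp_hasDerivAt t h

theorem differentiable_fderiv_apply {E : Type*} [NormedAddCommGroup E] [NormedSpace ℝ E]
    {F : E → ℝ} (hF : ContDiff ℝ 2 F) (v : E) :
    Differentiable ℝ (fun y => fderiv ℝ F y v) :=
  ((hF.fderiv_right (m := 1) (by norm_num)).clm_apply contDiff_const).differentiable (by norm_num)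

/-- Second derivative of a radial function in a tangential direction. -/
theorem fderiv_fderiv_radial_tangent {E : Type*} [NormedAddCommGroup E] [InnerProductSpace ℝ E]
    {F : E → ℝ} (hF : ContDiff ℝ 2 F) (hrad : ∀ x y : E, ‖x‖ = ‖y‖ → F x = F y) {e v : E}
    (he : ‖e‖ = 1) (hv : ‖v‖ = 1) (hev : ⟪e, v⟫ = 0) (t : ℝ) :
    t * fderiv ℝ (fun y => fderiv ℝ F y v) (t • e) v = fderiv ℝ F (t • e) e := by
  have hγ : HasDerivAt (fun s : ℝ => t • e + s • v) v 0 := by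
    have h := ((hasDerivAt_id (0 : ℝ)).smul_const v).const_add (t • e)
    simpa using h
  have hγ0 : t • e + (0 : ℝ) • v = t • e := by simp
  have hd : ∀ w : E, HasDerivAt (fun s : ℝ => fderiv ℝ F (t • e + s • v) w)
      (fderiv ℝ (fun y => fderiv ℝ F y w) (t • e) v) 0 := by
    intro w
    have h := (differentiable_fderiv_apply hF w (t • e + (0 : ℝ) • v)).hasFDerivAt
    have h := h.comp_hasDerivAt (0 : ℝ) hγ
    rw [hγ0] at h
    exact h
  have hve : ⟪v, e⟫ = 0 := by rw [real_inner_comm]; exact hev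
  have key : (fun s : ℝ => t * fderiv ℝ F (t • e + s • v) v)
      = fun s => s * fderiv ℝ F (t • e + s • v) e := by
    funext s
    have h := fderiv_radial_tangent hrad (x := t • e + s • v) (v := t • v - s • e)
      (hF.differentiable (by norm_num) _)
      (by
        simp only [inner_add_left, inner_sub_right, real_inner_smul_left, real_inner_smul_right,
          hev, hve, real_inner_self_eq_norm_sq, he, hv]
        ring)
      (by
        rw [← sq_eq_sq₀ (norm_nonneg _) (norm_nonneg _), norm_add_sq_real, norm_sub_sq_real]
        simp only [norm_smul, real_inner_smul_left, real_inner_smul_right, hev, hve, he, hv]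
        ring)
    rw [map_sub, map_smul, map_smul, smul_eq_mul, smul_eq_mul] at h
    linarith
  have h1 := (hd v).const_mul t
  rw [key] at h1
  have h2 := (hasDerivAt_id (0 : ℝ)).mul (hd e)
  have h3 := h1.unique h2
  simpa using h3

/-- The Laplacian of a radial `C²` function in polar form along the first coordinate axis. -/
theorem lap_radial {F : R3 → ℝ} (hF : ContDiff ℝ 2 F)
    (hrad : ∀ x y : R3, ‖x‖ = ‖y‖ → F x = F y) {h p q : ℝ → ℝ}
    (hh : ∀ t, h t = F (t • EuclideanSpace.single 0 1))
    (hp : ∀ t, HasDerivAt h (p t) t) (hq : ∀ t, HasDerivAt p (q t) t) (t : ℝ) :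
    t * lap F (t • EuclideanSpace.single 0 1) = t * q t + 2 * p t := by
  obtain rfl : h = fun t => F (t • EuclideanSpace.single 0 1) := funext hh
  set e : R3 := EuclideanSpace.single 0 1 with he
  have hp' : p = fun t => fderiv ℝ F (t • e) e := funext fun t =>
    (hp t).unique (hasDerivAt_comp_smul_const (hF.differentiable (by norm_num)) e t)
  have hq' : q t = fderiv ℝ (fun y => fderiv ℝ F y e) (t • e) e := by
    refine (hq t).unique ?_
    rw [hp']
    exact hasDerivAt_comp_smul_const (differentiable_fderiv_apply hF e) e t
  have h1 := fderiv_fderiv_radial_tangent hF hrad (e := e)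
    (v := EuclideanSpace.single 1 1) (by simp [he]) (by simp) (by simp [he, EuclideanSpace.inner_single_left]) t
  have h2 := fderiv_fderiv_radial_tangent hF hrad (e := e)
    (v := EuclideanSpace.single 2 1) (by simp [he]) (by simp) (by simp [he, EuclideanSpace.inner_single_left]) t
  rw [lap, Fin.sum_univ_three, mul_add, mul_add, h1, h2, hq', hp']
  ring

/-- Uniqueness for the radial linear equation `q + (2/t) p + m h = 0`, where `p` and `q`
are the first and second derivatives of `h`, with vanishing data at the singular point `0`. -/
theorem radial_ode_eq_zero {h p q m : ℝ → ℝ} {M : ℝ} (hp : ∀ t, HasDerivAt h (p t) t)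
    (hq : ∀ t, HasDerivAt p (q t) t) (hm : ∀ t, |m t| ≤ M) (h0 : h 0 = 0) (p0 : p 0 = 0)
    (hode : ∀ t, 0 < t → t * q t + 2 * p t + t * (m t * h t) = 0) {t : ℝ} (ht : 0 ≤ t) :
    h t = 0 := by
  set E : ℝ → ℝ := fun t => (h t ^ 2 + p t ^ 2) * Real.exp (-(1 + M) * t) with hE
  have hEd : ∀ t, HasDerivAt E ((2 * h t * p t + 2 * p t * q t) * Real.exp (-(1 + M) * t)
      + (h t ^ 2 + p t ^ 2) * (Real.exp (-(1 + M) * t) * -(1 + M))) t := by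
    intro t
    have h1 := ((hp t).pow 2).add ((hq t).pow 2)
    have h2 := ((hasDerivAt_id t).const_mul (-(1 + M))).exp
    have h3 := h1.mul h2
    refine h3.congr_deriv ?_
    simp
  have hanti : AntitoneOn E (Set.Ici 0) := by
    refine antitoneOn_of_deriv_nonpos (convex_Ici 0)
      (fun t _ => (hEd t).continuousAt.continuousWithinAt)
      (fun t _ => (hEd t).differentiableAt.differentiableWithinAt) ?_
    intro t ht
    rw [interior_Ici, Set.mem_Ioi] at ht
    rw [(hEd t).deriv]
    have hqt : p t * q t = -(2 * p t ^ 2 / t) - m t * (h t * p t) := by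
      have := hode t ht
      field_simp
      linear_combination p t * this
    have hpos : 0 ≤ 2 * p t ^ 2 / t := by positivity
    have hmt := abs_le.mp (hm t)
    have hM : 0 ≤ M := (abs_nonneg _).trans (hm t)
    have hbound : -(m t * (2 * (h t * p t))) ≤ M * (h t ^ 2 + p t ^ 2) := by
      nlinarith [mul_nonneg (sub_nonneg.2 hmt.2) (sq_nonneg (h t - p t)),
        mul_nonneg (sub_nonneg.2 hmt.1) (sq_nonneg (h t + p t)),
        mul_nonneg (sub_nonneg.2 hmt.1) (sq_nonneg (h t - p t)),
        mul_nonneg (sub_nonneg.2 hmt.2) (sq_nonneg (h t + p t))]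
    have hexp := Real.exp_pos (-(1 + M) * t)
    have : 2 * h t * p t + 2 * p t * q t - (1 + M) * (h t ^ 2 + p t ^ 2) ≤ 0 := by
      nlinarith [sq_nonneg (h t - p t)]
    nlinarith
  have hle := hanti Set.self_mem_Ici ht ht
  have hE0 : E 0 = 0 := by simp [hE, h0, p0]
  rw [hE0] at hle
  have hexp := Real.exp_pos (-(1 + M) * t)
  have h1 : h t ^ 2 + p t ^ 2 ≤ 0 := nonpos_of_mul_nonpos_left hle hexp
  exact pow_eq_zero_iff (two_ne_zero) |>.1 (by nlinarith [sq_nonneg (h t), sq_nonneg (p t)])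

/-- The profile `t ↦ (s² + t²)^(-1/2)`, a multiple of the rescaled bubble. -/
def bubbleProfile (s t : ℝ) : ℝ := (s ^ 2 + t ^ 2) ^ (-(1 : ℝ) / 2)

section Profile

variable {s : ℝ}

theorem bubbleProfile_pos (hs : 0 < s) (t : ℝ) : 0 < bubbleProfile s t :=
  Real.rpow_pos_of_pos (by positivity) _

theorem bubbleProfile_sq (hs : 0 < s) (t : ℝ) :
    bubbleProfile s t ^ 2 = (s ^ 2 + t ^ 2)⁻¹ := by
  rw [bubbleProfile, ← Real.rpow_natCast, ← Real.rpow_mul (by positivity), ← Real.rpow_neg_one]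
  norm_num

theorem bubbleProfile_sq_mul (hs : 0 < s) (t : ℝ) :
    bubbleProfile s t ^ 2 * (s ^ 2 + t ^ 2) = 1 := by
  rw [bubbleProfile_sq hs]
  exact inv_mul_cancel₀ (by positivity)

theorem bubbleProfile_eq_smul (hs : 0 < s) (t : ℝ) :
    (1 + (s⁻¹ * t) ^ 2) ^ (-(1 : ℝ) / 2) = s * bubbleProfile s t := by
  have h : 1 + (s⁻¹ * t) ^ 2 = (s ^ 2 + t ^ 2) * (s ^ 2)⁻¹ := by field_simp
  rw [h, Real.mul_rpow (by positivity) (by positivity), bubbleProfile, mul_comm,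
    Real.inv_rpow (by positivity), ← Real.rpow_natCast s 2, ← Real.rpow_mul hs.le,
    ← Real.rpow_neg hs.le]
  norm_num

theorem hasDerivAt_bubbleProfile (hs : 0 < s) (t : ℝ) :
    HasDerivAt (bubbleProfile s) (-(t * bubbleProfile s t ^ 3)) t := by
  have hpos : 0 < s ^ 2 + t ^ 2 := by positivity
  have h1 := ((hasDerivAt_pow 2 t).const_add (s ^ 2)).rpow_const (p := -(1 : ℝ) / 2)
    (Or.inl hpos.ne')
  refine h1.congr_deriv ?_
  have h2 : (s ^ 2 + t ^ 2) ^ (-(1 : ℝ) / 2 - 1) = bubbleProfile s t ^ 3 := by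
    rw [bubbleProfile, ← Real.rpow_natCast _ 3, ← Real.rpow_mul hpos.le]
    norm_num
  rw [h2]
  push_cast
  ring

theorem continuous_bubbleProfile (hs : 0 < s) : Continuous (bubbleProfile s) :=
  continuous_iff_continuousAt.2 fun t => (hasDerivAt_bubbleProfile hs t).continuousAt

/-- The radial derivative of the dilation mode `V/2 - t² V³` of the bubble profile `V`. -/
theorem hasDerivAt_dilationProfile (hs : 0 < s) (t : ℝ) :
    HasDerivAt (fun t => bubbleProfile s t / 2 - t ^ 2 * bubbleProfile s t ^ 3)
      (-(5 / 2) * t * bubbleProfile s t ^ 3 + 3 * t ^ 3 * bubbleProfile s t ^ 5) t := by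
  have hV := hasDerivAt_bubbleProfile hs t
  refine ((hV.div_const 2).sub ((hasDerivAt_pow 2 t).mul (hV.pow 3))).congr_deriv ?_
  norm_num
  ring

theorem integrable_bubbleProfile_sq (hs : 0 < s) :
    Integrable (fun t => bubbleProfile s t ^ 2) := by
  have h := (integrable_inv_one_add_sq.comp_div hs.ne').const_mul ((s ^ 2)⁻¹)
  refine h.congr (Filter.Eventually.of_forall fun t => ?_)
  simp only
  rw [bubbleProfile_sq hs, ← mul_inv]
  congr 1
  field_simp

theorem hasDerivAt_bubbleProfile_deriv (hs : 0 < s) (t : ℝ) :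
    HasDerivAt (fun t => -(t * bubbleProfile s t ^ 3))
      (-bubbleProfile s t ^ 3 + 3 * t ^ 2 * bubbleProfile s t ^ 5) t := by
  refine ((hasDerivAt_id t).mul ((hasDerivAt_bubbleProfile hs t).pow 3)).neg.congr_deriv ?_
  norm_num
  ring

theorem hasDerivAt_dilationProfile_deriv (hs : 0 < s) (t : ℝ) :
    HasDerivAt
      (fun t => -(5 / 2) * t * bubbleProfile s t ^ 3 + 3 * t ^ 3 * bubbleProfile s t ^ 5)
      (-(5 / 2) * bubbleProfile s t ^ 3 + 33 / 2 * t ^ 2 * bubbleProfile s t ^ 5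
        - 15 * t ^ 4 * bubbleProfile s t ^ 7) t := by
  have hV := hasDerivAt_bubbleProfile hs t
  refine ((((hasDerivAt_id t).const_mul (-(5 / 2))).mul (hV.pow 3)).add
    (((hasDerivAt_pow 3 t).const_mul 3).mul (hV.pow 5))).congr_deriv ?_
  norm_num
  ring

theorem sq_mul_bubbleProfile_sq (hs : 0 < s) (t : ℝ) :
    t ^ 2 * bubbleProfile s t ^ 2 = 1 - s ^ 2 * bubbleProfile s t ^ 2 := by
  linear_combination bubbleProfile_sq_mul hs t

/-- The radial equation satisfied by the bubble profile. -/
theorem bubbleProfile_ode (hs : 0 < s) (t : ℝ) :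
    t * (-bubbleProfile s t ^ 3 + 3 * t ^ 2 * bubbleProfile s t ^ 5)
      + 2 * (-(t * bubbleProfile s t ^ 3)) = -3 * s ^ 2 * t * bubbleProfile s t ^ 5 := by
  linear_combination 3 * t * bubbleProfile s t ^ 3 * sq_mul_bubbleProfile_sq hs t

/-- The dilation mode solves the equation linearized at the bubble. -/
theorem dilationProfile_ode (hs : 0 < s) (t : ℝ) :
    t * (-(5 / 2) * bubbleProfile s t ^ 3 + 33 / 2 * t ^ 2 * bubbleProfile s t ^ 5
        - 15 * t ^ 4 * bubbleProfile s t ^ 7)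
      + 2 * (-(5 / 2) * t * bubbleProfile s t ^ 3 + 3 * t ^ 3 * bubbleProfile s t ^ 5)
      + t * (15 * s ^ 2 * bubbleProfile s t ^ 4
        * (bubbleProfile s t / 2 - t ^ 2 * bubbleProfile s t ^ 3)) = 0 := by
  linear_combination (t * bubbleProfile s t ^ 3 * (15 / 2 - 15 * t ^ 2 * bubbleProfile s t ^ 2)) *
    sq_mul_bubbleProfile_sq hs t

theorem hasFDerivAt_bubbleProfile_norm {E : Type*} [NormedAddCommGroup E] [InnerProductSpace ℝ E]
    (hs : 0 < s) (x : E) :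
    HasFDerivAt (fun x : E => bubbleProfile s ‖x‖) ((-bubbleProfile s ‖x‖ ^ 3) • innerSL ℝ x) x := by
  have hpos : 0 < s ^ 2 + ‖x‖ ^ 2 := by positivity
  have h1 := (((hasDerivAt_id (‖x‖ ^ 2)).const_add (s ^ 2)).rpow_const (p := -(1 : ℝ) / 2)
    (Or.inl hpos.ne')).comp_hasFDerivAt x (hasStrictFDerivAt_norm_sq x).hasFDerivAt
  refine h1.congr_fderiv ?_
  have h2 : (s ^ 2 + ‖x‖ ^ 2) ^ (-(1 : ℝ) / 2 - 1) = bubbleProfile s ‖x‖ ^ 3 := by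
    rw [bubbleProfile, ← Real.rpow_natCast _ 3, ← Real.rpow_mul hpos.le]
    norm_num
  ext y
  simp [h2]
  ring

theorem hasFDerivAt_dilationProfile_norm {E : Type*} [NormedAddCommGroup E]
    [InnerProductSpace ℝ E] (hs : 0 < s) (x : E) :
    HasFDerivAt (fun x : E => bubbleProfile s ‖x‖ / 2 - ‖x‖ ^ 2 * bubbleProfile s ‖x‖ ^ 3)
      ((-(5 / 2) * bubbleProfile s ‖x‖ ^ 3 + 3 * ‖x‖ ^ 2 * bubbleProfile s ‖x‖ ^ 5)
        • innerSL ℝ x) x := by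
  have hV := hasFDerivAt_bubbleProfile_norm hs x
  have h1 := (hV.const_mul (1 / 2)).sub
    ((hasStrictFDerivAt_norm_sq x).hasFDerivAt.mul (hV.pow 3))
  refine (h1.congr_fderiv ?_).congr_of_eventuallyEq
    (Filter.Eventually.of_forall fun y => by simp; ring)
  ext y
  simp
  ring

theorem contDiff_bubbleProfile_norm {E : Type*} [NormedAddCommGroup E] [InnerProductSpace ℝ E]
    (hs : 0 < s) : ContDiff ℝ 2 (fun x : E => bubbleProfile s ‖x‖) :=
  (contDiff_const.add (contDiff_norm_sq ℝ)).rpow_const_of_ne fun x => by positivity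

theorem integrable_bubbleProfile_energy (hs : 0 < s) :
    Integrable (fun x : R3 => ‖x‖ ^ 2 * bubbleProfile s ‖x‖ ^ 6) := by
  rw [integrable_fun_norm_addHaar volume (f := fun r => r ^ 2 * bubbleProfile s r ^ 6)]
  have hc := continuous_bubbleProfile hs
  refine (Integrable.mono' (integrable_bubbleProfile_sq hs) (by fun_prop)
    (Filter.Eventually.of_forall fun t => ?_)).integrableOn
  have h1 := sq_mul_bubbleProfile_sq hs t
  have h2 : 0 ≤ t ^ 2 * bubbleProfile s t ^ 2 := by positivity
  have h3 : t ^ 2 * bubbleProfile s t ^ 2 ≤ 1 := by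
    rw [h1]; nlinarith [sq_nonneg (s * bubbleProfile s t)]
  have h4 : (t ^ 2 * bubbleProfile s t ^ 2) ^ 2 ≤ 1 := pow_le_one₀ h2 h3
  simp only [finrank_euclideanSpace, Fintype.card_fin, smul_eq_mul, Nat.add_one_sub_one]
  rw [Real.norm_of_nonneg (by positivity)]
  nlinarith [mul_le_mul_of_nonneg_left h4 (sq_nonneg (bubbleProfile s t))]

theorem integrable_bubble_dilation_pairing (hs : 0 < s) :
    Integrable (fun x : R3 => 5 / 2 * ‖x‖ ^ 2 * bubbleProfile s ‖x‖ ^ 6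
      - 3 * ‖x‖ ^ 4 * bubbleProfile s ‖x‖ ^ 8) := by
  have hc := continuous_bubbleProfile hs
  refine Integrable.mono' ((integrable_bubbleProfile_energy hs).const_mul 6) (by fun_prop)
    (Filter.Eventually.of_forall fun x => ?_)
  have h1 := sq_mul_bubbleProfile_sq hs ‖x‖
  have h2 : 0 ≤ ‖x‖ ^ 2 * bubbleProfile s ‖x‖ ^ 2 := by positivity
  have h3 : ‖x‖ ^ 2 * bubbleProfile s ‖x‖ ^ 2 ≤ 1 := by
    rw [h1]; nlinarith [sq_nonneg (s * bubbleProfile s ‖x‖)]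
  have h4 : 0 ≤ ‖x‖ ^ 2 * bubbleProfile s ‖x‖ ^ 6 := by positivity
  rw [Real.norm_eq_abs, abs_le]
  constructor <;> nlinarith [mul_nonneg h4 h2, mul_le_mul_of_nonneg_left h3 h4]

/-- The bubble and its dilation mode are orthogonal in the energy inner product. -/
theorem integral_bubble_dilation_pairing (hs : 0 < s) :
    ∫ x : R3, (5 / 2 * ‖x‖ ^ 2 * bubbleProfile s ‖x‖ ^ 6
      - 3 * ‖x‖ ^ 4 * bubbleProfile s ‖x‖ ^ 8) = 0 := by
  have hint := integrable_bubble_dilation_pairing hs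
  rw [integrable_fun_norm_addHaar volume (f := fun r =>
    5 / 2 * r ^ 2 * bubbleProfile s r ^ 6 - 3 * r ^ 4 * bubbleProfile s r ^ 8)] at hint
  rw [integral_fun_norm_addHaar volume (fun r =>
    5 / 2 * r ^ 2 * bubbleProfile s r ^ 6 - 3 * r ^ 4 * bubbleProfile s r ^ 8)]
  have hderiv : ∀ t : ℝ, HasDerivAt (fun t => 1 / 2 * (t ^ 5 * bubbleProfile s t ^ 6))
      (t ^ (Module.finrank ℝ R3 - 1) •
        (5 / 2 * t ^ 2 * bubbleProfile s t ^ 6 - 3 * t ^ 4 * bubbleProfile s t ^ 8)) t := by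
    intro t
    refine (((hasDerivAt_pow 5 t).mul
      ((hasDerivAt_bubbleProfile hs t).pow 6)).const_mul (1 / 2)).congr_deriv ?_
    simp only [finrank_euclideanSpace, Fintype.card_fin, smul_eq_mul]
    norm_num
    ring
  have hlim : Filter.Tendsto (fun t => 1 / 2 * (t ^ 5 * bubbleProfile s t ^ 6)) Filter.atTop
      (nhds 0) := by
    have hinv : Filter.Tendsto (fun t : ℝ => t⁻¹) Filter.atTop (nhds 0) := tendsto_inv_atTop_zero
    refine squeeze_zero' ?_ ?_ hinv
    · filter_upwards [Filter.eventually_gt_atTop 0] with t ht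
      have := bubbleProfile_pos hs t
      positivity
    · filter_upwards [Filter.eventually_gt_atTop 0] with t ht
      have h1 := sq_mul_bubbleProfile_sq hs t
      have h2 : 0 ≤ t ^ 2 * bubbleProfile s t ^ 2 := by positivity
      have h3 : t ^ 2 * bubbleProfile s t ^ 2 ≤ 1 := by
        rw [h1]; nlinarith [sq_nonneg (s * bubbleProfile s t)]
      have h4 : (t ^ 2 * bubbleProfile s t ^ 2) ^ 3 ≤ 1 := pow_le_one₀ h2 h3
      rw [inv_eq_one_div, le_div_iff₀ ht]
      nlinarith [pow_nonneg h2 3]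
  rw [integral_Ioi_of_hasDerivAt_of_tendsto' (fun t _ => hderiv t) hint hlim]
  simp

end Profile

theorem gradient_eq_smul_of_hasFDerivAt {E : Type*} [NormedAddCommGroup E]
    [InnerProductSpace ℝ E] [CompleteSpace E] {f : E → ℝ} {c : ℝ} {x : E}
    (h : HasFDerivAt f (c • innerSL ℝ x) x) : gradient f x = c • x := by
  refine HasGradientAt.gradient (hasGradientAt_iff_hasFDerivAt.2 (h.congr_fderiv ?_))
  ext y
  simp

/-- The Dirichlet energy scales linearly under dilations of `ℝ³`. -/
theorem integral_norm_gradient_sq_comp_smul (f : R3 → ℝ) {s : ℝ} (hs : 0 < s) :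
    ∫ x : R3, ‖gradient (fun y => f (s⁻¹ • y)) x‖ ^ 2 = s * ∫ x : R3, ‖gradient f x‖ ^ 2 := by
  have h : ∀ x : R3, ‖gradient (fun y => f (s⁻¹ • y)) x‖ ^ 2
      = (s⁻¹) ^ 2 * ‖gradient f (s⁻¹ • x)‖ ^ 2 := by
    intro x
    simp only [gradient, LinearIsometryEquiv.norm_map]
    rw [fderiv_comp_smul, norm_smul, mul_pow, Real.norm_eq_abs, sq_abs]
  simp_rw [h]
  rw [integral_const_mul, Measure.integral_comp_inv_smul_of_nonneg volume
    (fun x : R3 => ‖gradient f x‖ ^ 2) hs.le]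
  simp only [finrank_euclideanSpace, Fintype.card_fin, smul_eq_mul]
  field_simp

/-- A radial `C²` solution of the equation linearized at the bubble, with a source term
proportional to the fifth power of the bubble, is spanned by the bubble and its dilation mode. -/
theorem eq_bubble_add_dilation {s A : ℝ} (hs : 0 < s) {φ : R3 → ℝ} (hφ : ContDiff ℝ 2 φ)
    (hrad : ∀ x y : R3, ‖x‖ = ‖y‖ → φ x = φ y)
    (heq : ∀ t, 0 < t → lap φ (t • EuclideanSpace.single 0 1)
      + 15 * s ^ 2 * bubbleProfile s t ^ 4 * φ (t • EuclideanSpace.single 0 1)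
      = 12 * A * s ^ 2 * bubbleProfile s t ^ 5) :
    ∃ l : ℝ, ∀ x, φ x = A * bubbleProfile s ‖x‖
      + l * (bubbleProfile s ‖x‖ / 2 - ‖x‖ ^ 2 * bubbleProfile s ‖x‖ ^ 3) := by
  set e : R3 := EuclideanSpace.single 0 1 with he
  have hnorm : ‖e‖ = 1 := by simp [he]
  set V := bubbleProfile s with hVdef
  have hV0 : 0 < V 0 := bubbleProfile_pos hs 0
  set l : ℝ := 2 * (φ 0 - A * V 0) / V 0 with hl
  have hp := hasDerivAt_comp_smul_const (hφ.differentiable (by norm_num)) e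
  have hq := hasDerivAt_comp_smul_const (differentiable_fderiv_apply hφ e) e
  have hp0 : fderiv ℝ φ ((0 : ℝ) • e) e = 0 := by
    have h := fderiv_fderiv_radial_tangent hφ hrad (e := e)
      (v := EuclideanSpace.single 1 1) hnorm (by simp) (by simp [he, EuclideanSpace.inner_single_left]) 0
    rw [← h, zero_mul]
  refine ⟨l, fun x => ?_⟩
  have hzero := radial_ode_eq_zero (M := 15 / s ^ 2)
    (m := fun t => 15 * s ^ 2 * V t ^ 4)
    (fun t => ((hp t).sub ((hasDerivAt_bubbleProfile hs t).const_mul A)).sub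
      ((hasDerivAt_dilationProfile hs t).const_mul l))
    (fun t => ((hq t).sub ((hasDerivAt_bubbleProfile_deriv hs t).const_mul A)).sub
      ((hasDerivAt_dilationProfile_deriv hs t).const_mul l))
    (fun t => by
      have h1 := bubbleProfile_sq_mul hs t
      have h2 : s ^ 2 * V t ^ 2 ≤ 1 := by nlinarith [sq_nonneg (t * V t)]
      have h3 : (s ^ 2 * V t ^ 2) ^ 2 ≤ 1 := pow_le_one₀ (by positivity) h2
      rw [abs_of_nonneg (by positivity), le_div_iff₀ (by positivity)]
      nlinarith)
    (by
      have h1 : l * (V 0 / 2) = φ 0 - A * V 0 := by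
        rw [hl]
        field_simp
      simp only [Pi.sub_apply, zero_smul]
      linear_combination -h1)
    (by rw [hp0]; simp)
    (fun t ht => by
      have h1 := lap_radial hφ hrad (fun _ => rfl) hp hq t
      have h2 := heq t ht
      rw [Pi.sub_apply, Pi.sub_apply]
      clear_value l
      linear_combination -h1 + t * h2 - A * bubbleProfile_ode hs t
        - l * dilationProfile_ode hs t)
    (norm_nonneg x)
  have hx : φ (‖x‖ • e) = φ x := hrad _ _ (by simp [norm_smul, hnorm])
  simp only [Pi.sub_apply, hx] at hzero
  linear_combination hzero

/-- radial nondegeneracy: let `u(x) = Q(x/√c)` with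
`√c = (bk + √(b²k² + 4a))/2`, `k = ∫|∇Q|²`, be the positive radial solution of the Kirchhoff
equation. If `φ` is a radially symmetric finite-energy `C²` function with `L₊φ = 0` pointwise,
where `L₊φ = -(a + b∫|∇u|²)Δφ - 2b(∫∇u·∇φ)Δu - 5u⁴φ`, then `φ = λ(u/2 + x·∇u)` for some
`λ ∈ ℝ`. -/
theorem kirchhoff_radial_nondegeneracy (a b : ℝ) (ha : 0 < a) (hb : 0 < b)
    (k : ℝ) (hk : k = ∫ x : R3, ‖gradient Qb x‖ ^ 2)
    (sc : ℝ) (hsc : sc = (b * k + Real.sqrt (b ^ 2 * k ^ 2 + 4 * a)) / 2)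
    (u : R3 → ℝ) (hu : ∀ x, u x = Qb (sc⁻¹ • x))
    (φ : R3 → ℝ) (hφreg : ContDiff ℝ 2 φ) (hφrad : ∀ x y : R3, ‖x‖ = ‖y‖ → φ x = φ y)
    (hφfin : Integrable (fun x : R3 => ‖gradient φ x‖ ^ 2))
    (hker : ∀ x, -((a + b * ∫ y : R3, ‖gradient u y‖ ^ 2) * lap φ x)
      - 2 * b * (∫ y : R3, ⟪gradient u y, gradient φ y⟫) * lap u x
      - 5 * u x ^ 4 * φ x = 0) :
    ∃ l : ℝ, ∀ x, φ x = l * (u x / 2 + ⟪x, gradient u x⟫) := by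
  have hk0 : 0 ≤ k := by rw [hk]; exact integral_nonneg fun x => by positivity
  have hsqrt := Real.sqrt_pos.2 (show 0 < b ^ 2 * k ^ 2 + 4 * a by positivity)
  have hs : 0 < sc := by rw [hsc]; positivity
  have hquad : sc ^ 2 = a + b * (sc * k) := by
    have h := Real.sq_sqrt (show 0 ≤ b ^ 2 * k ^ 2 + 4 * a by positivity)
    rw [hsc]
    linear_combination h / 4
  set K : ℝ := (3 : ℝ) ^ ((1 : ℝ) / 4) with hKdef
  have hK : 0 < K := Real.rpow_pos_of_pos (by norm_num) _
  have hK4 : K ^ 4 = 3 := by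
    rw [hKdef, ← Real.rpow_natCast, ← Real.rpow_mul (by norm_num)]
    norm_num
  have huV : ∀ x, u x = K * sc * bubbleProfile sc ‖x‖ := by
    intro x
    rw [hu, Qb, norm_smul, Real.norm_of_nonneg (inv_pos.2 hs).le, bubbleProfile_eq_smul hs,
      mul_assoc]
  have hEu : ∫ y : R3, ‖gradient u y‖ ^ 2 = sc * k := by
    rw [hk, funext hu]
    exact integral_norm_gradient_sq_comp_smul Qb hs
  have hgu : ∀ x, gradient u x = (K * sc * (-bubbleProfile sc ‖x‖ ^ 3)) • x := by
    intro x
    refine gradient_eq_smul_of_hasFDerivAt ?_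
    rw [funext huV, mul_smul]
    exact (hasFDerivAt_bubbleProfile_norm hs x).const_mul _
  have hEJ : sc * k = (K * sc) ^ 2 * ∫ x : R3, ‖x‖ ^ 2 * bubbleProfile sc ‖x‖ ^ 6 := by
    rw [← hEu, ← integral_const_mul]
    refine integral_congr_ae (Filter.Eventually.of_forall fun x => ?_)
    simp only [hgu, norm_smul, mul_pow, Real.norm_eq_abs, sq_abs]
    ring
  have hlapu : ∀ t, 0 < t → lap u (t • EuclideanSpace.single 0 1)
      = -3 * K * sc ^ 3 * bubbleProfile sc t ^ 5 := by
    intro t ht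
    have hureg : ContDiff ℝ 2 u := by
      rw [funext huV]
      exact contDiff_const.mul (contDiff_bubbleProfile_norm hs)
    have heven : ∀ t, bubbleProfile sc |t| = bubbleProfile sc t := fun t => by
      rw [bubbleProfile, sq_abs, bubbleProfile]
    have h := lap_radial hureg (fun x y hxy => by rw [huV, huV, hxy])
      (fun t => by rw [huV, norm_smul, PiLp.norm_single, norm_one, mul_one,
        Real.norm_eq_abs, heven])
      (fun t => (hasDerivAt_bubbleProfile hs t).const_mul (K * sc))
      (fun t => (hasDerivAt_bubbleProfile_deriv hs t).const_mul (K * sc)) t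
    refine mul_left_cancel₀ ht.ne' ?_
    linear_combination h + K * sc * bubbleProfile_ode hs t
  set I : ℝ := ∫ y : R3, ⟪gradient u y, gradient φ y⟫ with hI
  rw [hEu, ← hquad] at hker
  obtain ⟨l, hφ⟩ := eq_bubble_add_dilation (A := b * I / (2 * sc ^ 2) * (K * sc)) hs hφreg hφrad
    (fun t ht => by
      have h := hker (t • EuclideanSpace.single 0 1)
      rw [hlapu t ht, huV, norm_smul, PiLp.norm_single, norm_one, mul_one,
        Real.norm_of_nonneg ht.le, mul_pow, mul_pow, hK4] at h
      have hA : b * I / (2 * sc ^ 2) * (K * sc) * sc ^ 2 = b * I * K * sc / 2 := by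
        field_simp
      refine mul_left_cancel₀ (pow_pos hs 2).ne' ?_
      linear_combination -h - 12 * sc ^ 2 * bubbleProfile sc t ^ 5 * hA)
  have hgφ : ∀ x, gradient φ x = (b * I / (2 * sc ^ 2) * (K * sc) * (-bubbleProfile sc ‖x‖ ^ 3)
      + l * (-(5 / 2) * bubbleProfile sc ‖x‖ ^ 3
        + 3 * ‖x‖ ^ 2 * bubbleProfile sc ‖x‖ ^ 5)) • x := by
    intro x
    refine gradient_eq_smul_of_hasFDerivAt ?_
    rw [funext hφ, add_smul, mul_smul, mul_smul l]
    exact ((hasFDerivAt_bubbleProfile_norm hs x).const_mul _).add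
      ((hasFDerivAt_dilationProfile_norm hs x).const_mul _)
  have hIval : I = b * I / (2 * sc ^ 2) * (sc * k) := by
    have h : ∀ x : R3, ⟪gradient u x, gradient φ x⟫
        = b * I / (2 * sc ^ 2) * (K * sc) ^ 2 * (‖x‖ ^ 2 * bubbleProfile sc ‖x‖ ^ 6)
          + K * sc * l * (5 / 2 * ‖x‖ ^ 2 * bubbleProfile sc ‖x‖ ^ 6
            - 3 * ‖x‖ ^ 4 * bubbleProfile sc ‖x‖ ^ 8) := by
      intro x
      rw [hgu, hgφ, real_inner_smul_left, real_inner_smul_right, real_inner_self_eq_norm_sq]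
      ring
    calc I = ∫ x : R3, ⟪gradient u x, gradient φ x⟫ := hI
      _ = _ := integral_congr_ae (Filter.Eventually.of_forall h)
      _ = b * I / (2 * sc ^ 2) * (sc * k) := by
        rw [integral_add ((integrable_bubbleProfile_energy hs).const_mul _)
          ((integrable_bubble_dilation_pairing hs).const_mul _), integral_const_mul,
          integral_const_mul, integral_bubble_dilation_pairing hs, hEJ]
        ring
  have hI0 : I = 0 := by
    have h1 : I * (sc ^ 2 + a) = 0 := by
      field_simp at hIval
      linear_combination sc * hIval - I * hquad
    exact (mul_eq_zero.1 h1).resolve_right (by positivity)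
  refine ⟨l / (K * sc), fun x => ?_⟩
  rw [hφ x, hI0, hgu, huV, real_inner_smul_right, real_inner_self_eq_norm_sq]
  field_simp
  ring
end
end
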